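/- There exist constants c₁, c₂ > 0 such that for all real H ≥ 3 one has c₁·H²(log H)² ≤ N_{D₄}(H) ≤ c₂·H²(log H)². -/

import Mathlib

open Polynomial in
/-- The number of monic, irreducible quartic polynomials with integer coefficients
bounded by `H` in absolute value whose Galois group is isomorphic to `G`. -/
noncomputable def quarticGalCount (G : Type*) [Group G] (H : ℝ) : ℕ :=
  Set.ncard {p : ℤ × ℤ × ℤ × ℤ |
    |(p.1 : ℝ)| ≤ H ∧ |(p.2.1 : ℝ)| ≤ H ∧ |(p.2.2.1 : ℝ)| ≤ H ∧ |(p.2.2.2 : ℝ)| ≤ H ∧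
    Irreducible (X ^ 4 + C (p.1 : ℚ) * X ^ 3 + C (p.2.1 : ℚ) * X ^ 2 + C (p.2.2.1 : ℚ) * X
        + C (p.2.2.2 : ℚ)) ∧
    Nonempty
      ((X ^ 4 + C (p.1 : ℚ) * X ^ 3 + C (p.2.1 : ℚ) * X ^ 2 + C (p.2.2.1 : ℚ) * X
          + C (p.2.2.2 : ℚ)).Gal ≃* G)}

section

open Polynomial

/-- The quartic `X⁴ + aX³ + bX² + cX + d` as a rational polynomial. -/
noncomputable def quartic (a b c d : ℤ) : ℚ[X] :=
  X ^ 4 + C (a : ℚ) * X ^ 3 + C (b : ℚ) * X ^ 2 + C (c : ℚ) * X + C (d : ℚ)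

theorem quartic_natDegree (a b c d : ℤ) : (quartic a b c d).natDegree = 4 := by
  unfold quartic; compute_degree!

theorem quartic_monic (a b c d : ℤ) : (quartic a b c d).Monic := by
  unfold quartic; monicity!

/-- Vieta's relations for a quartic over a field in which it splits. -/
theorem quartic_exists_roots {K : Type*} [Field K] [Algebra ℚ K] (a b c d : ℤ)
    (hs : ((quartic a b c d).map (algebraMap ℚ K)).Splits) :
    ∃ x₁ x₂ x₃ x₄ : K,
      (a : K) = -(x₁ + x₂ + x₃ + x₄) ∧
      (b : K) = x₁ * x₂ + x₁ * x₃ + x₁ * x₄ + x₂ * x₃ + x₂ * x₄ + x₃ * x₄ ∧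
      (c : K) = -(x₁ * x₂ * x₃ + x₁ * x₂ * x₄ + x₁ * x₃ * x₄ + x₂ * x₃ * x₄) ∧
      (d : K) = x₁ * x₂ * x₃ * x₄ := by
  set f := quartic a b c d with hf
  have hm : (f.map (algebraMap ℚ K)).Monic := (quartic_monic a b c d).map _
  have hcard : Multiset.card (f.map (algebraMap ℚ K)).roots = 4 := by
    rw [splits_iff_card_roots.1 hs, natDegree_map, hf, quartic_natDegree]
  obtain ⟨x₁, x₂, x₃, x₄, hx⟩ := Multiset.card_eq_four.1 hcard
  have hprod := hs.eq_prod_roots_of_monic hm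
  rw [hx] at hprod
  have hmap : f.map (algebraMap ℚ K) = X ^ 4 + C (a : K) * X ^ 3 +
      C (b : K) * X ^ 2 + C (c : K) * X +
      C (d : K) := by
    conv_lhs => rw [hf]
    simp [quartic]
  have hexp : (Multiset.map (fun x => X - C x)
      ({x₁, x₂, x₃, x₄} : Multiset K)).prod =
      X ^ 4 + C (-(x₁ + x₂ + x₃ + x₄)) * X ^ 3 +
      C (x₁ * x₂ + x₁ * x₃ + x₁ * x₄ + x₂ * x₃ + x₂ * x₄ + x₃ * x₄) * X ^ 2 +
      C (-(x₁ * x₂ * x₃ + x₁ * x₂ * x₄ + x₁ * x₃ * x₄ + x₂ * x₃ * x₄)) * X +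
      C (x₁ * x₂ * x₃ * x₄) := by
    simp only [Multiset.insert_eq_cons, Multiset.map_cons, Multiset.map_singleton,
      Multiset.prod_cons, Multiset.prod_singleton, C_add, C_mul, C_neg]
    ring
  rw [hmap, hexp] at hprod
  refine ⟨x₁, x₂, x₃, x₄, ?_, ?_, ?_, ?_⟩
  · have := congrArg (fun g => coeff g 3) hprod
    simpa [coeff_X, coeff_C, coeff_X_pow, -map_intCast, -map_add, -map_mul, -map_neg] using this
  · have := congrArg (fun g => coeff g 2) hprod
    simpa [coeff_X, coeff_C, coeff_X_pow, -map_intCast, -map_add, -map_mul, -map_neg] using this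
  · have := congrArg (fun g => coeff g 1) hprod
    simpa [coeff_X, coeff_C, coeff_X_pow, -map_intCast, -map_add, -map_mul, -map_neg] using this
  · have := congrArg (fun g => coeff g 0) hprod
    simpa [coeff_X, coeff_C, coeff_X_pow, -map_intCast, -map_add, -map_mul, -map_neg] using this

/-- An irreducible quartic whose Galois group has order eight has an integral root of its
cubic resolvent. -/
theorem exists_resolvent_root {a b c d : ℤ} (hirr : Irreducible (quartic a b c d))
    (hcard : Nat.card (quartic a b c d).Gal = 8) :
    ∃ x : ℤ, x ^ 3 - b * x ^ 2 + (a * c - 4 * d) * x - (a ^ 2 * d - 4 * b * d + c ^ 2) = 0 := by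
  obtain ⟨x₁, x₂, x₃, x₄, ha, hb, hc, hd⟩ := quartic_exists_roots a b c d
    (SplittingField.splits (quartic a b c d))
  rw [Gal.card_of_separable hirr.separable] at hcard
  let RZ : ℤ[X] := X ^ 3 + C (-b) * X ^ 2 + C (a * c - 4 * d) * X +
    C (-(a ^ 2 * d - 4 * b * d + c ^ 2))
  have hRZm : RZ.Monic := by simp only [RZ]; monicity!
  have hRZd : RZ.natDegree = 3 := by simp only [RZ]; compute_degree!
  let R : ℚ[X] := RZ.map (algebraMap ℤ ℚ)
  have hRm : R.Monic := hRZm.map _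
  have hRd : R.natDegree = 3 := by simp only [R]; rw [hRZm.natDegree_map, hRZd]
  have hroot : aeval (x₁ * x₂ + x₃ * x₄) R = 0 := by
    simp only [R, aeval_map_algebraMap, RZ]
    simp only [map_add, map_mul, map_pow, aeval_X, aeval_C, map_neg, map_sub]
    simp only [eq_intCast, Int.cast_ofNat, ha, hb, hc, hd]
    ring
  have hnot : ¬ Irreducible R := by
    intro hR
    have h1 := minpoly.eq_of_irreducible_of_monic hR hroot hRm
    have h2 := minpoly.degree_dvd (K := ℚ) (Algebra.IsIntegral.isIntegral (x₁ * x₂ + x₃ * x₄))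
    rw [← h1, hRd, hcard] at h2
    omega
  rw [hRm.irreducible_iff_roots_eq_zero_of_degree_le_three (by omega) (by omega)] at hnot
  obtain ⟨y, hy⟩ := Multiset.exists_mem_of_ne_zero hnot
  rw [mem_roots hRm.ne_zero, IsRoot.def, eval_map_algebraMap] at hy
  obtain ⟨x, hx⟩ := isInteger_of_is_root_of_monic hRZm hy
  refine ⟨x, ?_⟩
  rw [← hx, aeval_algebraMap_apply] at hy
  have := (algebraMap ℤ ℚ).injective_int (hy.trans (map_zero _).symm)
  simp [RZ] at this
  linarith

/-- A square root of a nonsquare integer is negated by some Galois automorphism. -/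
theorem exists_algEquiv_eq_neg {K : Type*} [Field K] [Algebra ℚ K] [FiniteDimensional ℚ K]
    [IsGalois ℚ K] {y : K} {n : ℤ} (hy : y ^ 2 = n) (hn : ¬ IsSquare n) :
    ∃ σ : K ≃ₐ[ℚ] K, σ y = -y := by
  by_contra! h
  have hfix : ∀ σ : K ≃ₐ[ℚ] K, σ y = y := by
    intro σ
    have : σ y ^ 2 = y ^ 2 := by rw [← map_pow, hy, map_intCast]
    exact (sq_eq_sq_iff_eq_or_eq_neg.1 this).resolve_right (h σ)
  obtain ⟨z, hz⟩ := IntermediateField.mem_bot.1 ((IsGalois.mem_bot_iff_fixed y).2 hfix)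
  have hz2 : z ^ 2 = n := by
    apply (algebraMap ℚ K).injective
    rw [map_pow, hz, hy, map_intCast]
  exact hn (Rat.isSquare_intCast_iff.1 ⟨z, by rw [← hz2, sq]⟩)

/-- The regular permutation action of the dihedral group of order eight on a square. -/
def dihedralPerm : DihedralGroup 4 →* Equiv.Perm (ZMod 4) where
  toFun
    | .r i => Equiv.addLeft i
    | .sr i => Equiv.subLeft (-i)
  map_one' := by decide
  map_mul' := by decide

theorem dihedralPerm_injective : Function.Injective dihedralPerm := by
  decide

/-- A group of order eight acting faithfully on four points is dihedral. -/
theorem nonempty_mulEquiv_dihedral {G α : Type*} [Group G] [Fintype α]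
    (hα : Fintype.card α = 4) (φ : G →* Equiv.Perm α) (hφ : Function.Injective φ)
    (hG : Nat.card G = 8) : Nonempty (G ≃* DihedralGroup 4) := by
  classical
  have e : α ≃ ZMod 4 := Fintype.equivOfCardEq (by rw [hα, ZMod.card])
  let ψ : G →* Equiv.Perm (ZMod 4) := (e.permCongrHom : Equiv.Perm α →* _).comp φ
  have hψ : Function.Injective ψ := e.permCongrHom.injective.comp hφ
  have hfac : (8 : ℕ) = 2 ^ (Nat.card (Equiv.Perm (ZMod 4))).factorization 2 := by
    have h24 : Nat.card (Equiv.Perm (ZMod 4)) = 2 ^ 3 * 3 := by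
      rw [Nat.card_perm, Nat.card_zmod]; rfl
    rw [h24, Nat.factorization_mul (by norm_num) (by norm_num),
      Nat.Prime.factorization_pow Nat.prime_two, Nat.Prime.factorization Nat.prime_three]
    simp
  have h1 : Nat.card ψ.range = 2 ^ (Nat.card (Equiv.Perm (ZMod 4))).factorization 2 := by
    rw [← hfac, ← hG]
    exact (Nat.card_congr (MonoidHom.ofInjective hψ).toEquiv).symm
  have h2 : Nat.card dihedralPerm.range =
      2 ^ (Nat.card (Equiv.Perm (ZMod 4))).factorization 2 := by
    rw [← hfac, ← Nat.card_congr (MonoidHom.ofInjective dihedralPerm_injective).toEquiv,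
      DihedralGroup.nat_card]
  exact ⟨((MonoidHom.ofInjective hψ).trans
    (Sylow.equiv (Sylow.ofCard _ h1) (Sylow.ofCard _ h2))).trans
    (MonoidHom.ofInjective dihedralPerm_injective).symm⟩

/-- Over a field where the quartic splits, its roots can be grouped into two pairs defined over
a quadratic extension, provided the quartic is a norm from that extension. -/
theorem exists_paired_roots {K : Type*} [Field K] [CharZero K] [Algebra ℚ K] {a b c d : ℤ}
    {u p q r s : ℤ} (hs0 : s ≠ 0) (ha : a = 2 * p) (hb : b = p ^ 2 - u * q ^ 2 + 2 * r)
    (hc : c = 2 * (p * r - u * q * s)) (hd : d = r ^ 2 - u * s ^ 2)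
    (hs : ((quartic a b c d).map (algebraMap ℚ K)).Splits) :
    ∃ x₁ x₂ x₃ x₄ w : K,
      (∀ y : K, y ^ 4 + a * y ^ 3 + b * y ^ 2 + c * y + d =
        (y - x₁) * (y - x₂) * (y - x₃) * (y - x₄)) ∧
      w ^ 2 = u ∧ x₁ + x₂ = -p - q * w ∧ x₃ + x₄ = -p + q * w ∧
      x₁ * x₂ = r + s * w ∧ x₃ * x₄ = r - s * w := by
  have hsK : (s : K) ≠ 0 := Int.cast_ne_zero.2 hs0
  have h2s : (2 * s : K) ≠ 0 := mul_ne_zero two_ne_zero hsK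
  suffices H : ∃ x₁ x₂ x₃ x₄ : K,
      ((a : K) = -(x₁ + x₂ + x₃ + x₄) ∧
      (b : K) = x₁ * x₂ + x₁ * x₃ + x₁ * x₄ + x₂ * x₃ + x₂ * x₄ + x₃ * x₄ ∧
      (c : K) = -(x₁ * x₂ * x₃ + x₁ * x₂ * x₄ + x₁ * x₃ * x₄ + x₂ * x₃ * x₄) ∧
      (d : K) = x₁ * x₂ * x₃ * x₄) ∧ x₁ * x₂ + x₃ * x₄ = 2 * r by
    obtain ⟨x₁, x₂, x₃, x₄, ⟨ea, eb, ec, ed⟩, hr⟩ := H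
    have ea' := ea; have eb' := eb; have ec' := ec; have ed' := ed
    rw [ha] at ea'; rw [hb] at eb'; rw [hc] at ec'; rw [hd] at ed'
    push_cast at ea' eb' ec' ed'
    refine ⟨x₁, x₂, x₃, x₄, (x₁ * x₂ - x₃ * x₄) / (2 * s), ?_, ?_, ?_⟩
    · intro y
      rw [ea, eb, ec, ed]
      ring
    · rw [div_pow, div_eq_iff (pow_ne_zero 2 h2s)]
      linear_combination (x₁ * x₂ + x₃ * x₄ + 2 * r) * hr + 4 * ed'
    · generalize hw : (x₁ * x₂ - x₃ * x₄) / (2 * s) = w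
      rw [div_eq_iff h2s] at hw
      have h12 : x₁ * x₂ = r + s * w := by linear_combination (hr + hw) / 2
      have h34 : x₃ * x₄ = r - s * w := by linear_combination (hr - hw) / 2
      have hw2 : w ^ 2 = u := by
        have : (s : K) ^ 2 * (w ^ 2 - u) = 0 := by
          linear_combination x₃ * x₄ * h12 + (r + s * w) * h34 + ed'
        rcases mul_eq_zero.1 this with h | h
        · exact absurd h (pow_ne_zero 2 hsK)
        · exact sub_eq_zero.1 h
      have hdiff : x₁ + x₂ - (x₃ + x₄) = -2 * q * w := by
        by_cases hw0 : w = 0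
        · have hu0 : (u : K) = 0 := by rw [← hw2, hw0]; ring
          have : (x₁ + x₂ - (x₃ + x₄)) ^ 2 = 0 := by
            linear_combination (x₁ + x₂ + x₃ + x₄ - 2 * p) * ea' + 4 * hr + 4 * eb' +
              4 * q ^ 2 * hu0
          rw [pow_eq_zero_iff two_ne_zero] at this
          rw [this, hw0]; ring
        · have : (s : K) * w * (x₁ + x₂ - (x₃ + x₄) + 2 * q * w) = 0 := by
            linear_combination (x₃ + x₄) * h12 + (x₁ + x₂) * h34 - ec'
              + r * ea' + 2 * q * s * hw2
          rcases mul_eq_zero.1 this with h | h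
          · exact absurd h (mul_ne_zero hsK hw0)
          · linear_combination h
      refine ⟨?_, ?_, h12, h34⟩
      · linear_combination (hdiff + ea') / 2
      · linear_combination (ea' - hdiff) / 2
  obtain ⟨x₁, x₂, x₃, x₄, ea, eb, ec, ed⟩ := quartic_exists_roots a b c d hs
  have hres : ((x₁ * x₂ + x₃ * x₄) - 2 * r) * ((x₁ * x₃ + x₂ * x₄) - 2 * r) *
      ((x₁ * x₄ + x₂ * x₃) - 2 * r) = 0 := by
    have h1 : (2 * r : K) ^ 3 - b * (2 * r) ^ 2 + (a * c - 4 * d) * (2 * r)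
        - (a ^ 2 * d - 4 * b * d + c ^ 2) = 0 := by
      rw [ha, hb, hc, hd]; push_cast; ring
    rw [ea, eb, ec, ed] at h1
    linear_combination -h1
  rcases mul_eq_zero.1 hres with h | h
  · rcases mul_eq_zero.1 h with h | h
    · exact ⟨x₁, x₂, x₃, x₄, ⟨ea, eb, ec, ed⟩, sub_eq_zero.1 h⟩
    · refine ⟨x₁, x₃, x₂, x₄, ⟨?_, ?_, ?_, ?_⟩, sub_eq_zero.1 h⟩
      · rw [ea]; ring
      · rw [eb]; ring
      · rw [ec]; ring
      · rw [ed]; ring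
  · refine ⟨x₁, x₄, x₂, x₃, ⟨?_, ?_, ?_, ?_⟩, sub_eq_zero.1 h⟩
    · rw [ea]; ring
    · rw [eb]; ring
    · rw [ec]; ring
    · rw [ed]; ring

theorem four_le_natDegree_minpoly {K : Type*} [Field K] [Algebra ℚ K] [FiniteDimensional ℚ K]
    (σ : K ≃ₐ[ℚ] K) {x : K} (h2 : σ (σ x) ≠ x) (h4 : σ (σ (σ (σ x))) = x) :
    4 ≤ (minpoly ℚ x).natDegree := by
  classical
  have hxint : IsIntegral ℚ x := Algebra.IsIntegral.isIntegral x
  have hmem : ∀ y, aeval y (minpoly ℚ x) = 0 → aeval (σ y) (minpoly ℚ x) = 0 := by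
    intro y hy
    rw [aeval_algEquiv, AlgHom.comp_apply, hy]
    exact map_zero _
  have h0 := minpoly.aeval ℚ x
  have h1 : x ≠ σ x := fun h => h2 (by rw [← h, ← h])
  have hsub : ({x, σ x, σ (σ x), σ (σ (σ x))} : Finset K) ⊆ ((minpoly ℚ x).aroots K).toFinset := by
    intro y hy
    simp only [Finset.mem_insert, Finset.mem_singleton] at hy
    rw [Multiset.mem_toFinset, mem_aroots]
    refine ⟨minpoly.ne_zero hxint, ?_⟩
    rcases hy with rfl | rfl | rfl | rfl
    · exact h0
    · exact hmem _ h0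
    · exact hmem _ (hmem _ h0)
    · exact hmem _ (hmem _ (hmem _ h0))
  have hcard : ({x, σ x, σ (σ x), σ (σ (σ x))} : Finset K).card = 4 := by
    have h3 : x ≠ σ (σ (σ x)) := fun h => h1 (by
      have := congrArg σ h
      rw [h4] at this
      exact this.symm)
    rw [Finset.card_insert_of_notMem, Finset.card_insert_of_notMem, Finset.card_insert_of_notMem,
      Finset.card_singleton]
    · simpa using h1
    · simp only [Finset.mem_insert, Finset.mem_singleton, not_or, EmbeddingLike.apply_eq_iff_eq]
      exact ⟨h1, fun h => h2 h.symm⟩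
    · simp only [Finset.mem_insert, Finset.mem_singleton, not_or]
      exact ⟨h1, fun h => h2 h.symm, h3⟩
  calc 4 = _ := hcard.symm
    _ ≤ _ := Finset.card_le_card hsub
    _ ≤ _ := Multiset.toFinset_card_le _
    _ ≤ (minpoly ℚ x).natDegree := by
      rw [aroots_def]
      exact (card_roots' _).trans (natDegree_map_le)

theorem apply_apply_eq_self_of_sq {K : Type*} [Field K] [Algebra ℚ K] (g : K ≃ₐ[ℚ] K) {y : K}
    (h : g y ^ 2 = y ^ 2) : g (g y) = y := by
  rcases sq_eq_sq_iff_eq_or_eq_neg.1 h with h | h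
  · rw [h, h]
  · rw [h, map_neg, h, neg_neg]

/-- Irreducibility and Galois group order data for a quartic that is a norm from a quadratic
field, over a Galois extension generated by its roots. -/
theorem quartic_norm_form_group {K : Type*} [Field K] [CharZero K] [Algebra ℚ K]
    [FiniteDimensional ℚ K] [IsGalois ℚ K] {a b c d u p q r s D : ℤ} (hs0 : s ≠ 0)
    (ha : a = 2 * p) (hb : b = p ^ 2 - u * q ^ 2 + 2 * r)
    (hc : c = 2 * (p * r - u * q * s)) (hd : d = r ^ 2 - u * s ^ 2)
    (hD : D = (p ^ 2 + u * q ^ 2 - 4 * r) ^ 2 - u * (2 * p * q - 4 * s) ^ 2)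
    (hu : ¬ IsSquare u) (hDsq : ¬ IsSquare D) (huD : ¬ IsSquare (u * D))
    (hsplit : ((quartic a b c d).map (algebraMap ℚ K)).Splits)
    (hext : ∀ g : K ≃ₐ[ℚ] K, (∀ y ∈ (quartic a b c d).rootSet K, g y = y) → g = 1) :
    Irreducible (quartic a b c d) ∧ 4 ∣ Nat.card (K ≃ₐ[ℚ] K) ∧ ¬ 3 ∣ Nat.card (K ≃ₐ[ℚ] K) ∧
      Nat.card (K ≃ₐ[ℚ] K) ≠ 4 := by
  obtain ⟨x₁, x₂, x₃, x₄, w, hprod, hw, h12, h34, hm12, hm34⟩ :=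
    exists_paired_roots hs0 ha hb hc hd hsplit
  set e := x₁ - x₂ with he
  set e' := x₃ - x₄ with he'
  have hx₁ : x₁ = (-p - q * w + e) / 2 := by linear_combination (h12 + he) / 2
  have hx₂ : x₂ = (-p - q * w - e) / 2 := by linear_combination (h12 - he) / 2
  have hx₃ : x₃ = (-p + q * w + e') / 2 := by linear_combination (h34 + he') / 2
  have hx₄ : x₄ = (-p + q * w - e') / 2 := by linear_combination (h34 - he') / 2
  have hesq : e ^ 2 = (p + q * w) ^ 2 - 4 * (r + s * w) := by
    linear_combination (e + x₁ - x₂) * he + (x₁ + x₂ - p - q * w) * h12 - 4 * hm12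
  have he'sq : e' ^ 2 = (p - q * w) ^ 2 - 4 * (r - s * w) := by
    linear_combination (e' + x₃ - x₄) * he' + (x₃ + x₄ - p + q * w) * h34 - 4 * hm34
  have hDK : (e * e') ^ 2 = (D : K) := by
    rw [mul_pow, hesq, he'sq, hD]
    push_cast
    rw [← hw]
    ring
  have hD0 : (D : K) ≠ 0 := by
    rw [Int.cast_ne_zero]
    rintro rfl
    exact hDsq ⟨0, rfl⟩
  have hee : e * e' ≠ 0 := fun h => hD0 (by rw [← hDK, h]; ring)
  have he0 : e ≠ 0 := left_ne_zero_of_mul hee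
  have hu0 : u ≠ 0 := by
    rintro rfl
    exact hu ⟨0, rfl⟩
  have hw0 : w ≠ 0 := by
    rintro rfl
    refine hu0 ?_
    have : (u : K) = 0 := by rw [← hw]; ring
    exact_mod_cast this
  have hgw : ∀ g : K ≃ₐ[ℚ] K, g w ^ 2 = w ^ 2 := by
    intro g; rw [← map_pow, hw, map_intCast]
  have hgee : ∀ g : K ≃ₐ[ℚ] K, g (e * e') ^ 2 = (e * e') ^ 2 := by
    intro g; rw [← map_pow, hDK, map_intCast]
  -- an automorphism negating both square roots
  obtain ⟨σ, hσw, hσe⟩ : ∃ σ : K ≃ₐ[ℚ] K,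
      σ w = -w ∧ σ (e * e') = -(e * e') := by
    obtain ⟨σ₁, h₁⟩ := exists_algEquiv_eq_neg hw hu
    obtain ⟨σ₂, h₂⟩ := exists_algEquiv_eq_neg hDK hDsq
    rcases sq_eq_sq_iff_eq_or_eq_neg.1 (hgee σ₁) with h₁' | h₁'
    · rcases sq_eq_sq_iff_eq_or_eq_neg.1 (hgw σ₂) with h₂' | h₂'
      · refine ⟨σ₁ * σ₂, ?_, ?_⟩
        · rw [AlgEquiv.mul_apply, h₂', h₁]
        · rw [AlgEquiv.mul_apply, h₂, map_neg, h₁']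
      · exact ⟨σ₂, h₂', h₂⟩
    · exact ⟨σ₁, h₁, h₁'⟩
  obtain ⟨τ, hτ⟩ := exists_algEquiv_eq_neg (y := w * (e * e')) (n := u * D)
    (by rw [mul_pow, hw, hDK]; push_cast; rfl) huD
  have hσe1 : σ e ^ 2 = e' ^ 2 := by
    rw [← map_pow, hesq, he'sq]
    simp only [map_sub, map_add, map_mul, map_pow, map_intCast, map_ofNat, hσw]
    ring
  have hσe2 : σ e' ^ 2 = e ^ 2 := by
    rw [← map_pow, hesq, he'sq]
    simp only [map_sub, map_mul, map_pow, map_intCast, map_ofNat, hσw]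
    ring
  have hσσ : σ (σ e) = -e := by
    rw [map_mul] at hσe
    rcases sq_eq_sq_iff_eq_or_eq_neg.1 hσe1 with h1 | h1 <;>
    rcases sq_eq_sq_iff_eq_or_eq_neg.1 hσe2 with h2 | h2
    · exfalso
      apply hee
      rw [h1, h2] at hσe
      linear_combination hσe / 2
    · rw [h1, h2]
    · rw [h1, map_neg, h2]
    · exfalso
      apply hee
      rw [h1, h2] at hσe
      linear_combination hσe / 2
  have hσσw : σ (σ w) = w := by rw [hσw, map_neg, hσw, neg_neg]
  have hσσx : σ (σ x₁) = x₂ := by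
    rw [hx₁, hx₂]
    simp only [map_div₀, map_sub, map_add, map_mul, map_neg, map_intCast, map_ofNat, hσσw, hσσ]
    ring
  have hσσx₂ : σ (σ x₂) = x₁ := by
    rw [hx₁, hx₂]
    simp only [map_div₀, map_sub, map_mul, map_neg, map_intCast, map_ofNat, hσσw, hσσ]
    ring
  have hirr : Irreducible (quartic a b c d) := by
    have hxint : IsIntegral ℚ x₁ := Algebra.IsIntegral.isIntegral x₁
    have hdeg : 4 ≤ (minpoly ℚ x₁).natDegree := by
      apply four_le_natDegree_minpoly σ
      · rw [hσσx]
        intro h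
        exact he0 (by rw [he, h, sub_self])
      · rw [hσσx, hσσx₂]
    have hdvd : minpoly ℚ x₁ ∣ quartic a b c d := by
      apply minpoly.dvd
      have := hprod x₁
      rw [sub_self, zero_mul, zero_mul, zero_mul] at this
      rw [← this]
      simp [quartic]
    have : quartic a b c d = minpoly ℚ x₁ := by
      refine eq_of_monic_of_dvd_of_natDegree_le (minpoly.monic hxint) (quartic_monic a b c d) hdvd ?_

      rw [quartic_natDegree]
      exact hdeg
    rw [this]
    exact minpoly.irreducible hxint
  have hpow : ∀ g : K ≃ₐ[ℚ] K, g ^ 4 = 1 := by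
    intro g
    refine hext _ ?_
    have hggw : g (g w) = w := apply_apply_eq_self_of_sq g (hgw g)
    have hge : g (g (g (g e))) = e := by
      apply apply_apply_eq_self_of_sq (g * g)
      rw [AlgEquiv.mul_apply, ← map_pow, ← map_pow, hesq]
      simp only [map_sub, map_add, map_mul, map_pow, map_intCast, map_ofNat, hggw]
    have hge' : g (g (g (g e'))) = e' := by
      apply apply_apply_eq_self_of_sq (g * g)
      rw [AlgEquiv.mul_apply, ← map_pow, ← map_pow, he'sq]
      simp only [map_sub, map_mul, map_pow, map_intCast, map_ofNat, hggw]
    intro y hy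
    have hy' : (y - x₁) * (y - x₂) * (y - x₃) * (y - x₄) = 0 := by
      rw [← hprod, ← (mem_rootSet.1 hy).2]
      simp [quartic]
    have hg4 : (g ^ 4) y = g (g (g (g y))) := rfl
    rw [hg4]
    simp only [mul_eq_zero, sub_eq_zero] at hy'
    rcases hy' with ((rfl | rfl) | rfl) | rfl
    · rw [hx₁]
      simp only [map_div₀, map_sub, map_add, map_mul, map_neg, map_intCast, map_ofNat, hggw, hge]
    · rw [hx₂]
      simp only [map_div₀, map_sub, map_mul, map_neg, map_intCast, map_ofNat, hggw, hge]
    · rw [hx₃]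
      simp only [map_div₀, map_add, map_mul, map_neg, map_intCast, map_ofNat, hggw, hge']
    · rw [hx₄]
      simp only [map_div₀, map_sub, map_add, map_mul, map_neg, map_intCast, map_ofNat, hggw, hge']
  have hord : orderOf σ = 4 := by
    refine orderOf_eq_prime_pow (p := 2) (n := 1) ?_ (hpow σ)
    intro h
    have h' : σ (σ e) = e := DFunLike.congr_fun h e
    rw [hσσ] at h'
    exact he0 (by linear_combination -h' / 2)
  have h4 : 4 ∣ Nat.card (K ≃ₐ[ℚ] K) := hord ▸ orderOf_dvd_natCard σ
  have h3 : ¬ 3 ∣ Nat.card (K ≃ₐ[ℚ] K) := by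
    intro h
    obtain ⟨g, hg⟩ := exists_prime_orderOf_dvd_card' (G := K ≃ₐ[ℚ] K) 3 h
    have := orderOf_dvd_of_pow_eq_one (hpow g)
    rw [hg] at this
    omega
  have hne4 : Nat.card (K ≃ₐ[ℚ] K) ≠ 4 := by
    intro h
    have htop : Subgroup.zpowers σ = ⊤ :=
      Subgroup.eq_top_of_card_eq _ (by rw [Nat.card_zpowers, hord, h])
    have hle : Subgroup.zpowers σ ≤
        MulAction.stabilizer _ (w * (e * e')) := by
      rw [Subgroup.zpowers_le, MulAction.mem_stabilizer_iff, AlgEquiv.smul_def, map_mul, hσw, hσe]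
      ring
    have hτ' : τ ∈ Subgroup.zpowers σ := by
      rw [htop]; exact Subgroup.mem_top _
    have := hle hτ'
    rw [MulAction.mem_stabilizer_iff, AlgEquiv.smul_def, hτ] at this
    exact mul_ne_zero hw0 hee (by linear_combination -this / 2)
  exact ⟨hirr, h4, h3, hne4⟩

theorem isGalois_splittingField {F : Type*} [Field F] [CharZero F] (f : F[X]) :
    IsGalois F f.SplittingField :=
  { to_isSeparable := inferInstance, to_normal := Normal.of_isSplittingField f }

/-- A quartic that is a norm from a quadratic field is irreducible with dihedral Galois group
as soon as the three relevant integers are not squares. -/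
theorem quartic_dihedral {a b c d u p q r s D : ℤ} (hs0 : s ≠ 0)
    (ha : a = 2 * p) (hb : b = p ^ 2 - u * q ^ 2 + 2 * r)
    (hc : c = 2 * (p * r - u * q * s)) (hd : d = r ^ 2 - u * s ^ 2)
    (hD : D = (p ^ 2 + u * q ^ 2 - 4 * r) ^ 2 - u * (2 * p * q - 4 * s) ^ 2)
    (hu : ¬ IsSquare u) (hDsq : ¬ IsSquare D) (huD : ¬ IsSquare (u * D)) :
    Irreducible (quartic a b c d) ∧
      Nonempty ((quartic a b c d).Gal ≃* DihedralGroup 4) := by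
  have hsplit := SplittingField.splits (quartic a b c d)
  let _ : Algebra ℚ (quartic a b c d).SplittingField := SplittingField.instAlgebra_1 _
  have hgal : IsGalois ℚ (quartic a b c d).SplittingField :=
    isGalois_splittingField (quartic a b c d)
  obtain ⟨hirr, h4, h3, hne4⟩ := quartic_norm_form_group hs0 ha hb hc hd hD hu hDsq huD hsplit
    (fun g hg => Gal.ext _ hg)
  refine ⟨hirr, ?_⟩
  have : Fact ((quartic a b c d).map
    (algebraMap ℚ (quartic a b c d).SplittingField)).Splits := ⟨hsplit⟩
  have hrc : Nat.card ((quartic a b c d).rootSet (quartic a b c d).SplittingField) = 4 := by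
    rw [Nat.card_eq_fintype_card]
    exact (card_rootSet_eq_natDegree hirr.separable hsplit).trans (quartic_natDegree a b c d)
  have hφ := Gal.galActionHom_injective (quartic a b c d) (quartic a b c d).SplittingField
  refine nonempty_mulEquiv_dihedral (by rw [← Nat.card_eq_fintype_card]; exact hrc)
    (Gal.galActionHom (quartic a b c d) (quartic a b c d).SplittingField) hφ ?_
  have hdvd : Nat.card (quartic a b c d).Gal ∣ 24 := by
    have := Subgroup.card_dvd_of_injective _ hφ
    rwa [Nat.card_perm, hrc] at this
  have hle : Nat.card (quartic a b c d).Gal ≤ 24 := Nat.le_of_dvd (by norm_num) hdvd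
  change 4 ∣ Nat.card (quartic a b c d).Gal at h4
  change ¬ 3 ∣ Nat.card (quartic a b c d).Gal at h3
  change Nat.card (quartic a b c d).Gal ≠ 4 at hne4
  generalize Nat.card (quartic a b c d).Gal = n at *
  interval_cases n <;> omega


/-- The integers of absolute value at most `R`. -/
noncomputable def intBall (R : ℝ) : Finset ℤ := Finset.Icc (-⌊R⌋) ⌊R⌋

theorem mem_intBall {R : ℝ} {x : ℤ} : x ∈ intBall R ↔ |(x : ℝ)| ≤ R := by
  rw [intBall, Finset.mem_Icc, abs_le, neg_le, Int.le_floor, Int.le_floor, Int.cast_neg, neg_le]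

/-- A finite set of integers of diameter at most `L` has at most `L + 1` elements. -/
theorem card_le_of_forall_abs_sub_le {S : Finset ℤ} {L : ℝ} (hL : 0 ≤ L)
    (h : ∀ x ∈ S, ∀ y ∈ S, |(x : ℝ) - y| ≤ L) : (S.card : ℝ) ≤ L + 1 := by
  rcases S.eq_empty_or_nonempty with rfl | hS
  · simp; linarith
  have hsub : S ⊆ Finset.Icc (S.min' hS) (S.max' hS) := fun x hx =>
    Finset.mem_Icc.2 ⟨S.min'_le x hx, S.le_max' x hx⟩
  have h1 := Finset.card_le_card hsub
  rw [Int.card_Icc] at h1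
  have h2 : S.min' hS ≤ S.max' hS := S.min'_le _ (S.max'_mem hS)
  have h3 : (S.card : ℤ) ≤ S.max' hS + 1 - S.min' hS := by omega
  have h4 : (S.card : ℝ) ≤ S.max' hS + 1 - S.min' hS := by exact_mod_cast h3
  have h5 := (abs_le.1 (h _ (S.max'_mem hS) _ (S.min'_mem hS))).2
  linarith

theorem card_le_of_forall_abs_le {S : Finset ℤ} {L : ℝ} (hL : 0 ≤ L)
    (h : ∀ x ∈ S, |(x : ℝ)| ≤ L) : (S.card : ℝ) ≤ 2 * L + 1 :=
  card_le_of_forall_abs_sub_le (by linarith) fun x hx y hy =>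
    (abs_sub _ _).trans (by linarith [h x hx, h y hy])

theorem card_intBall_le {R : ℝ} (hR : 0 ≤ R) : ((intBall R).card : ℝ) ≤ 2 * R + 1 :=
  card_le_of_forall_abs_le hR fun _ => mem_intBall.1

theorem sum_intBall_inv_le {R : ℝ} (hR : 1 ≤ R) :
    ∑ x ∈ intBall R, |(x : ℝ)|⁻¹ ≤ 2 * (1 + Real.log R) := by
  have hnat : ∑ n ∈ Finset.Icc 1 ⌊R⌋₊, ((n : ℝ))⁻¹ ≤ 1 + Real.log R := by
    have h := harmonic_floor_le_one_add_log R hR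
    rw [harmonic_eq_sum_Icc] at h
    push_cast at h
    exact h
  have hsub : intBall R ⊆ {0} ∪ (Finset.Icc 1 ⌊R⌋₊).image (fun n : ℕ => (n : ℤ)) ∪
      (Finset.Icc 1 ⌊R⌋₊).image (fun n : ℕ => -(n : ℤ)) := by
    intro x hx
    have hx' : x.natAbs ≤ ⌊R⌋₊ := by
      apply Nat.le_floor
      rw [Nat.cast_natAbs, Int.cast_abs]
      exact mem_intBall.1 hx
    simp only [Finset.mem_union, Finset.mem_singleton, Finset.mem_image, Finset.mem_Icc]
    rcases lt_trichotomy x 0 with h | h | h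
    · exact Or.inr ⟨x.natAbs, ⟨by omega, hx'⟩, by omega⟩
    · exact Or.inl (Or.inl h)
    · exact Or.inl (Or.inr ⟨x.natAbs, ⟨by omega, hx'⟩, by omega⟩)
  have h0 : ∀ x : ℤ, 0 ≤ |(x : ℝ)|⁻¹ := fun x => inv_nonneg.2 (abs_nonneg _)
  have hunion : ∀ s t : Finset ℤ, ∑ x ∈ s ∪ t, |(x : ℝ)|⁻¹ ≤
      ∑ x ∈ s, |(x : ℝ)|⁻¹ + ∑ x ∈ t, |(x : ℝ)|⁻¹ := fun s t => by
    rw [← Finset.sum_union_inter]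
    exact le_add_of_nonneg_right (Finset.sum_nonneg fun x _ => h0 x)
  have e1 : ∑ x ∈ (Finset.Icc 1 ⌊R⌋₊).image (fun n : ℕ => (n : ℤ)), |(x : ℝ)|⁻¹ =
      ∑ n ∈ Finset.Icc 1 ⌊R⌋₊, ((n : ℝ))⁻¹ := by
    rw [Finset.sum_image fun x _ y _ h => by simpa using h]
    simp
  have e2 : ∑ x ∈ (Finset.Icc 1 ⌊R⌋₊).image (fun n : ℕ => -(n : ℤ)), |(x : ℝ)|⁻¹ =
      ∑ n ∈ Finset.Icc 1 ⌊R⌋₊, ((n : ℝ))⁻¹ := by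
    rw [Finset.sum_image fun x _ y _ h => by simpa using h]
    simp
  calc _ ≤ _ := Finset.sum_le_sum_of_subset_of_nonneg hsub fun x _ _ => h0 x
    _ ≤ _ := hunion _ _
    _ ≤ _ := add_le_add_left (hunion _ _) _
    _ ≤ _ := by
      rw [e1, e2]
      simp
      linarith

/-- A bound for the size of a finite set of pairs from bounds for the projection to the first
coordinate and its fibres. -/
theorem card_le_mul_of_fibers {S : Finset (ℤ × ℤ)} {m n : ℝ} (hm : 0 ≤ m)
    (h1 : ((S.image Prod.fst).card : ℝ) ≤ n)
    (h2 : ∀ x ∈ S.image Prod.fst, (((S.filter fun y => y.1 = x).image Prod.snd).card : ℝ) ≤ m) :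
    (S.card : ℝ) ≤ m * n := by
  have h := Finset.card_le_mul_card_image (f := Prod.fst) S ⌊m⌋₊ fun x hx => by
    apply Nat.le_floor
    have hx' := h2 x hx
    rwa [Finset.card_image_of_injOn] at hx'
    intro y hy z hz hyz
    simp only [Finset.coe_filter, Set.mem_ofPred_eq] at hy hz
    exact Prod.ext (hy.2.trans hz.2.symm) hyz
  calc (S.card : ℝ) ≤ ((⌊m⌋₊ * (S.image Prod.fst).card : ℕ) : ℝ) := by exact_mod_cast h
    _ = ⌊m⌋₊ * ((S.image Prod.fst).card : ℝ) := by push_cast; rfl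
    _ ≤ m * n := mul_le_mul (Nat.floor_le hm) h1 (Nat.cast_nonneg _) hm

/-- The number of integral points near a point of the curve `x² = uv²`, `a² = uw²`. -/
theorem card_near_le {H : ℝ} (hH : 1 ≤ H) {u v w : ℤ} (hu : u ≠ 0) (hv : v ≠ 0)
    (hwv : |w| ≤ |v|) (hM : |(u : ℝ)| * v ^ 2 ≤ 36 * H ^ 2) {S : Finset (ℤ × ℤ)}
    (hS : ∀ p ∈ S, |(p.1 : ℝ) ^ 2 - u * v ^ 2| ≤ 20 * H ∧ |(p.2 : ℝ) ^ 2 - u * w ^ 2| ≤ 20 * H ∧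
      |(p.1 : ℝ) * p.2 - u * v * w| ≤ 2 * H) :
    (S.card : ℝ) ≤ 10000 * (H ^ 2 * |(u : ℝ)|⁻¹ * ((v : ℝ) ^ 2)⁻¹) := by
  have hu1 : (1 : ℝ) ≤ |(u : ℝ)| := by exact_mod_cast Int.one_le_abs hu
  have hv1 : (1 : ℝ) ≤ (v : ℝ) ^ 2 := by
    rw [← sq_abs]
    exact one_le_pow₀ (by exact_mod_cast Int.one_le_abs hv)
  have hwv2 : (w : ℝ) ^ 2 ≤ (v : ℝ) ^ 2 := sq_le_sq.2 (by exact_mod_cast hwv)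
  obtain ⟨M, hM0, hMsq⟩ : ∃ M : ℝ, 0 ≤ M ∧ M ^ 2 = |(u : ℝ)| * v ^ 2 :=
    ⟨√(|(u : ℝ)| * v ^ 2), Real.sqrt_nonneg _, Real.sq_sqrt (by positivity)⟩
  obtain ⟨h, hh0, hhsq⟩ : ∃ h : ℝ, 0 ≤ h ∧ h ^ 2 = H := ⟨√H, Real.sqrt_nonneg _,
    Real.sq_sqrt (by linarith)⟩
  have hM1 : 1 ≤ M := by
    refine le_of_sq_le_sq ?_ hM0
    rw [hMsq]; nlinarith
  have hMH : M ≤ 6 * H := by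
    refine le_of_sq_le_sq ?_ (by linarith)
    rw [hMsq]; linarith
  have hMpos : 0 < M := by linarith
  have hh1 : 1 ≤ h := by
    refine le_of_sq_le_sq ?_ hh0
    linarith
  set R : ℝ := H / M with hR
  have hRM : R * M = H := by rw [hR]; field_simp
  have hR0 : 0 ≤ R := by positivity
  have hR1 : 1 ≤ 6 * R := by
    rw [hR, ← mul_div_assoc, le_div_iff₀ hMpos]; linarith
  have hgoal : 10000 * (H ^ 2 * |(u : ℝ)|⁻¹ * ((v : ℝ) ^ 2)⁻¹) = 10000 * R * R := by
    have : |(u : ℝ)|⁻¹ * ((v : ℝ) ^ 2)⁻¹ = (M ^ 2)⁻¹ := by rw [hMsq, mul_inv]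
    rw [mul_assoc (H ^ 2), this, hR]; field_simp
  rw [hgoal]
  have hfib : ∀ x : ℤ, ∀ a ∈ (S.filter fun y => y.1 = x).image Prod.snd, (x, a) ∈ S := by
    intro x a ha
    obtain ⟨p, hp, rfl⟩ := Finset.mem_image.1 ha
    obtain ⟨hp', rfl⟩ := Finset.mem_filter.1 hp
    exact hp'
  have huw : |(u : ℝ)| * w ^ 2 ≤ M ^ 2 := by
    rw [hMsq]; exact mul_le_mul_of_nonneg_left hwv2 (abs_nonneg _)
  -- a coarse bound, valid as soon as `M` is of size `√H`
  have hcoarse : M ^ 2 ≤ 27 * H → ∀ x : ℤ,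
      (((S.filter fun y => y.1 = x).image Prod.snd).card : ℝ) ≤ 90 * R := by
    intro hMs x
    have hMh : M ≤ 6 * h := by
      refine le_of_sq_le_sq ?_ (by linarith)
      nlinarith
    have hhR : h ≤ 6 * R := by
      rw [hR, ← mul_div_assoc, le_div_iff₀ hMpos]; nlinarith
    have := card_le_of_forall_abs_le (L := 7 * h) (by linarith) (S :=
      (S.filter fun y => y.1 = x).image Prod.snd) fun a ha => by
        have h2 := (abs_le.1 (hS _ (hfib x a ha)).2.1).2
        simp only at h2
        have h3 : (u : ℝ) * w ^ 2 ≤ |(u : ℝ)| * w ^ 2 :=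
          mul_le_mul_of_nonneg_right (le_abs_self _) (sq_nonneg _)
        apply abs_le_of_sq_le_sq _ (by linarith)
        nlinarith
    linarith
  have hfst : ∀ x ∈ S.image Prod.fst, ∃ a, (x, a) ∈ S := by
    intro x hx
    obtain ⟨p, hp, rfl⟩ := Finset.mem_image.1 hx
    exact ⟨p.2, hp⟩
  rcases lt_or_gt_of_ne hu with hneg | hpos
  · have hneg' : (u : ℝ) < 0 := by exact_mod_cast hneg
    rw [abs_of_neg hneg'] at hMsq
    have hx : ∀ x ∈ S.image Prod.fst, (x : ℝ) ^ 2 + M ^ 2 ≤ 20 * H := fun x hx => by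
      obtain ⟨a, ha⟩ := hfst x hx
      have := (abs_le.1 (hS _ ha).1).2
      simp only at this
      linarith
    rcases S.eq_empty_or_nonempty with rfl | ⟨p, hp⟩
    · simp; positivity
    have hMs : M ^ 2 ≤ 20 * H := by
      have := hx p.1 (Finset.mem_image_of_mem _ hp)
      nlinarith [sq_nonneg (p.1 : ℝ)]
    have hMh : M ≤ 5 * h := by
      refine le_of_sq_le_sq ?_ (by linarith)
      nlinarith
    have hhR : h ≤ 5 * R := by
      rw [hR, ← mul_div_assoc, le_div_iff₀ hMpos]; nlinarith
    have h1 := card_le_of_forall_abs_le (L := 5 * h) (by linarith) (S := S.image Prod.fst)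
      fun x hx' => by
        have h2 := hx x hx'
        apply abs_le_of_sq_le_sq _ (by linarith)
        nlinarith [sq_nonneg M]
    have := card_le_mul_of_fibers (S := S) (m := 90 * R) (n := 55 * R) (by linarith) (by linarith)
      fun x _ => hcoarse (by linarith) x
    nlinarith
  · have hpos' : (0 : ℝ) < u := by exact_mod_cast hpos
    rw [abs_of_pos hpos'] at hMsq
    have hx : ∀ x ∈ S.image Prod.fst, |(|(x : ℝ)| - M)| ≤ 20 * R := fun x hx => by
      obtain ⟨a, ha⟩ := hfst x hx
      have h1 := (hS _ ha).1
      simp only at h1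
      rw [← hMsq, ← sq_abs (x : ℝ), sq_sub_sq, abs_mul,
        abs_of_nonneg (by positivity : 0 ≤ |(x : ℝ)| + M)] at h1
      rw [hR, ← mul_div_assoc, le_div_iff₀ hMpos]
      refine le_trans ?_ h1
      rw [mul_comm]
      exact mul_le_mul_of_nonneg_right (by linarith [abs_nonneg (x : ℝ)]) (abs_nonneg _)
    have h1 : ((S.image Prod.fst).card : ℝ) ≤ 92 * R := by
      have hp := card_le_of_forall_abs_sub_le (L := 40 * R) (by linarith)
        (S := (S.image Prod.fst).filter fun x => 0 ≤ x) fun x hx' y hy' => by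
          rw [Finset.mem_filter] at hx' hy'
          have h1 := abs_le.1 (hx x hx'.1)
          have h2 := abs_le.1 (hx y hy'.1)
          rw [abs_of_nonneg (by exact_mod_cast hx'.2 : (0 : ℝ) ≤ x)] at h1
          rw [abs_of_nonneg (by exact_mod_cast hy'.2 : (0 : ℝ) ≤ y)] at h2
          rw [abs_le]; constructor <;> linarith
      have hn := card_le_of_forall_abs_sub_le (L := 40 * R) (by linarith)
        (S := (S.image Prod.fst).filter fun x => ¬ 0 ≤ x) fun x hx' y hy' => by
          rw [Finset.mem_filter, not_le] at hx' hy'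
          have h1 := abs_le.1 (hx x hx'.1)
          have h2 := abs_le.1 (hx y hy'.1)
          rw [abs_of_neg (by exact_mod_cast hx'.2 : (x : ℝ) < 0)] at h1
          rw [abs_of_neg (by exact_mod_cast hy'.2 : (y : ℝ) < 0)] at h2
          rw [abs_le]; constructor <;> linarith
      have hc := Finset.card_filter_add_card_filter_not (s := S.image Prod.fst) fun x => 0 ≤ x
      have hc' : ((S.image Prod.fst).card : ℝ) = (((S.image Prod.fst).filter fun x => 0 ≤ x).card : ℝ)
        + (((S.image Prod.fst).filter fun x => ¬ 0 ≤ x).card : ℝ) := by exact_mod_cast hc.symm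
      linarith
    have h2 : ∀ x ∈ S.image Prod.fst,
        (((S.filter fun y => y.1 = x).image Prod.snd).card : ℝ) ≤ 90 * R := fun x hx' => by
      rcases le_or_gt (M / 2) |(x : ℝ)| with hbig | hsmall
      · have := card_le_of_forall_abs_sub_le (L := 8 * R) (by linarith) (S :=
          (S.filter fun y => y.1 = x).image Prod.snd) fun a ha b hb => by
            have h3 := (hS _ (hfib x a ha)).2.2
            have h4 := (hS _ (hfib x b hb)).2.2
            simp only at h3 h4
            have h5 : |(x : ℝ)| * |(a : ℝ) - b| ≤ 4 * H := by
              rw [← abs_mul]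
              rw [abs_le] at h3 h4 ⊢
              constructor <;> linarith
            have h6 : M / 2 * |(a : ℝ) - b| ≤ 4 * H :=
              (mul_le_mul_of_nonneg_right hbig (abs_nonneg _)).trans h5
            rw [hR, ← mul_div_assoc, le_div_iff₀ hMpos]
            linarith
        linarith
      · refine hcoarse ?_ x
        obtain ⟨a, ha⟩ := hfst x hx'
        have h3 := (abs_le.1 (hS _ ha).1).1
        simp only at h3
        rw [← hMsq, ← sq_abs (x : ℝ)] at h3
        have h4 : |(x : ℝ)| ^ 2 ≤ (M / 2) ^ 2 := pow_le_pow_left₀ (abs_nonneg _) hsmall.le 2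
        linarith
    have := card_le_mul_of_fibers (S := S) (m := 90 * R) (n := 92 * R) (by linarith) h1 h2
    nlinarith

/-- The pairs of integers bounded by `4H` with product bounded by `2H`. -/
noncomputable def hyperbolaPairs (H : ℝ) : Finset (ℤ × ℤ) :=
  (intBall (4 * H) ×ˢ intBall (4 * H)).filter fun p => |(p.1 : ℝ) * p.2| ≤ 2 * H

theorem card_hyperbolaPairs_le {H : ℝ} (hH : 3 ≤ H) :
    ((hyperbolaPairs H).card : ℝ) ≤ 60 * H * Real.log H := by
  have hL : 1 ≤ Real.log H := by
    rw [Real.le_log_iff_exp_le (by linarith)]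
    linarith [Real.exp_one_lt_d9]
  have h4 : Real.log (4 * H) ≤ 3 + Real.log H := by
    rw [Real.log_mul (by norm_num) (by linarith)]
    linarith [Real.log_le_sub_one_of_pos (show (0 : ℝ) < 4 by norm_num)]
  have hmaps : Set.MapsTo Prod.fst (hyperbolaPairs H : Set (ℤ × ℤ)) (intBall (4 * H)) := by
    intro p hp
    exact (Finset.mem_product.1 (Finset.mem_filter.1 hp).1).1
  have hfib : ∀ x ∈ intBall (4 * H), (((hyperbolaPairs H).filter fun p => p.1 = x).card : ℝ) ≤
      4 * H * |(x : ℝ)|⁻¹ + 1 + if x = 0 then 8 * H else 0 := by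
    intro x _
    have hinj : Set.InjOn Prod.snd
        ((hyperbolaPairs H).filter fun p => p.1 = x : Set (ℤ × ℤ)) := by
      intro y hy z hz hyz
      exact Prod.ext ((Finset.mem_filter.1 hy).2.trans (Finset.mem_filter.1 hz).2.symm) hyz
    rw [← Finset.card_image_of_injOn hinj]
    by_cases hx : x = 0
    · have := card_le_of_forall_abs_le (L := 4 * H) (by linarith) (S :=
        ((hyperbolaPairs H).filter fun p => p.1 = x).image Prod.snd) fun a ha => by
          obtain ⟨p, hp, rfl⟩ := Finset.mem_image.1 ha
          exact mem_intBall.1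
            (Finset.mem_product.1 (Finset.mem_filter.1 (Finset.mem_filter.1 hp).1).1).2
      rw [if_pos hx]
      have h0 : 0 ≤ 4 * H * |(x : ℝ)|⁻¹ := by positivity
      linarith
    · have hx0 : 0 < |(x : ℝ)| := abs_pos.2 (by exact_mod_cast hx)
      have := card_le_of_forall_abs_le (L := 2 * H * |(x : ℝ)|⁻¹) (by positivity) (S :=
        ((hyperbolaPairs H).filter fun p => p.1 = x).image Prod.snd) fun a ha => by
          obtain ⟨p, hp, rfl⟩ := Finset.mem_image.1 ha
          have h2 := (Finset.mem_filter.1 (Finset.mem_filter.1 hp).1).2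
          rw [(Finset.mem_filter.1 hp).2, abs_mul] at h2
          rw [← div_eq_mul_inv, le_div_iff₀ hx0]
          linarith
      rw [if_neg hx]
      linarith
  have hsum := sum_intBall_inv_le (R := 4 * H) (by linarith)
  have hcard := card_intBall_le (R := 4 * H) (by linarith)
  rw [Finset.card_eq_sum_card_fiberwise hmaps, Nat.cast_sum]
  calc _ ≤ _ := Finset.sum_le_sum hfib
    _ = 4 * H * ∑ x ∈ intBall (4 * H), |(x : ℝ)|⁻¹ + (intBall (4 * H)).card
        + ∑ x ∈ intBall (4 * H), if x = 0 then 8 * H else 0 := by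
      rw [Finset.sum_add_distrib, Finset.sum_add_distrib, ← Finset.mul_sum]
      simp
    _ ≤ 4 * H * (2 * (1 + (3 + Real.log H))) + (2 * (4 * H) + 1) + 8 * H := by
      gcongr
      · linarith
      · rw [Finset.sum_ite_eq']
        split_ifs <;> linarith
    _ ≤ _ := by nlinarith

/-- The pairs `(x, a)` close to the points with `x² = uv²`, `a² = uw²`. -/
noncomputable def nearPairs (H : ℝ) (u v w : ℤ) : Finset (ℤ × ℤ) :=
  (intBall (4 * H) ×ˢ intBall (4 * H)).filter fun p =>
    |(p.1 : ℝ) ^ 2 - u * v ^ 2| ≤ 20 * H ∧ |(p.2 : ℝ) ^ 2 - u * w ^ 2| ≤ 20 * H ∧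
      |(p.1 : ℝ) * p.2 - u * v * w| ≤ 2 * H

theorem abs_mul_sq_le {H : ℝ} (hH : 1 ≤ H) {u v x : ℤ} (hx : |(x : ℝ)| ≤ 4 * H)
    (h : |(x : ℝ) ^ 2 - u * v ^ 2| ≤ 20 * H) : |(u : ℝ)| * v ^ 2 ≤ 36 * H ^ 2 := by
  rw [← abs_of_nonneg (sq_nonneg (v : ℝ)), ← abs_mul]
  have h2 : (x : ℝ) ^ 2 ≤ (4 * H) ^ 2 := sq_le_sq' (by linarith [(abs_le.1 hx).1]) (abs_le.1 hx).2
  rw [abs_le] at h ⊢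
  constructor <;> nlinarith [sq_nonneg (x : ℝ)]

theorem card_nearPairs_le {H : ℝ} (hH : 1 ≤ H) {u v w : ℤ} (hu : u ≠ 0) (hv : v ≠ 0)
    (hw : w ≠ 0) : ((nearPairs H u v w).card : ℝ) ≤ 10000 * H ^ 2 * (|(u : ℝ)|⁻¹ *
      ((if |w| ≤ |v| then ((v : ℝ) ^ 2)⁻¹ else 0) +
        (if |v| ≤ |w| then ((w : ℝ) ^ 2)⁻¹ else 0))) := by
  rcases (nearPairs H u v w).eq_empty_or_nonempty with he | ⟨p, hp⟩
  · rw [he]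
    simp only [Finset.card_empty, Nat.cast_zero]
    have h1 : (0 : ℝ) ≤ if |w| ≤ |v| then ((v : ℝ) ^ 2)⁻¹ else 0 := by positivity
    have h2 : (0 : ℝ) ≤ if |v| ≤ |w| then ((w : ℝ) ^ 2)⁻¹ else 0 := by positivity
    positivity
  have hp' := Finset.mem_filter.1 hp
  have hpr := Finset.mem_product.1 hp'.1
  rcases le_total |w| |v| with h | h
  · have := card_near_le hH hu hv h (abs_mul_sq_le hH (mem_intBall.1 hpr.1) hp'.2.1)
      (S := nearPairs H u v w) fun p hp => (Finset.mem_filter.1 hp).2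
    rw [if_pos h]
    have h2 : (0 : ℝ) ≤ if |v| ≤ |w| then ((w : ℝ) ^ 2)⁻¹ else 0 := by positivity
    calc _ ≤ _ := this
      _ = 10000 * H ^ 2 * (|(u : ℝ)|⁻¹ * (((v : ℝ) ^ 2)⁻¹ + 0)) := by ring
      _ ≤ _ := by gcongr
  · have := card_near_le hH hu hw h (abs_mul_sq_le hH (mem_intBall.1 hpr.2) hp'.2.2.1)
      (S := (nearPairs H u v w).image Prod.swap) fun p hp => by
        obtain ⟨q, hq, rfl⟩ := Finset.mem_image.1 hp
        obtain ⟨h1, h2, h3⟩ := (Finset.mem_filter.1 hq).2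
        refine ⟨h2, h1, ?_⟩
        simp only [Prod.fst_swap, Prod.snd_swap]
        rwa [mul_comm (q.2 : ℝ), mul_right_comm]
    rw [Finset.card_image_of_injective _ Prod.swap_injective] at this
    rw [if_pos h]
    have h2 : (0 : ℝ) ≤ if |w| ≤ |v| then ((v : ℝ) ^ 2)⁻¹ else 0 := by positivity
    calc _ ≤ _ := this
      _ = 10000 * H ^ 2 * (|(u : ℝ)|⁻¹ * (0 + ((w : ℝ) ^ 2)⁻¹)) := by ring
      _ ≤ _ := by gcongr

theorem sum_ite_abs_le_le {R : ℝ} (hR : 1 ≤ R) :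
    ∑ v ∈ (intBall R).erase 0, ∑ w ∈ (intBall R).erase 0,
      (if |w| ≤ |v| then ((v : ℝ) ^ 2)⁻¹ else 0) ≤ 6 * (1 + Real.log R) := by
  calc _ ≤ ∑ v ∈ (intBall R).erase 0, 3 * |(v : ℝ)|⁻¹ := by
        refine Finset.sum_le_sum fun v hv => ?_
        have hv0 : (v : ℝ) ≠ 0 := by exact_mod_cast (Finset.mem_erase.1 hv).1
        have hv1 : (1 : ℝ) ≤ |(v : ℝ)| := by
          exact_mod_cast Int.one_le_abs (Finset.mem_erase.1 hv).1
        rw [← Finset.sum_filter, Finset.sum_const, nsmul_eq_mul]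
        have := card_le_of_forall_abs_le (L := |(v : ℝ)|) (abs_nonneg _)
          (S := ((intBall R).erase 0).filter fun w => |w| ≤ |v|) fun w hw => by
            exact_mod_cast (Finset.mem_filter.1 hw).2
        calc _ ≤ (3 * |(v : ℝ)|) * ((v : ℝ) ^ 2)⁻¹ := by gcongr; linarith
          _ = _ := by rw [← sq_abs]; field_simp
    _ ≤ ∑ v ∈ intBall R, 3 * |(v : ℝ)|⁻¹ :=
        Finset.sum_le_sum_of_subset_of_nonneg (Finset.erase_subset _ _) fun _ _ _ => by positivity
    _ ≤ _ := by
        rw [← Finset.mul_sum]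
        linarith [sum_intBall_inv_le hR]

theorem sum_card_nearPairs_le {H : ℝ} (hH : 3 ≤ H) :
    ∑ u ∈ (intBall (36 * H ^ 2)).erase 0, ∑ v ∈ (intBall (6 * H)).erase 0,
      ∑ w ∈ (intBall (6 * H)).erase 0, ((nearPairs H u v w).card : ℝ) ≤
      22000000 * H ^ 2 * Real.log H ^ 2 := by
  have hL : 1 ≤ Real.log H := by
    rw [Real.le_log_iff_exp_le (by linarith)]
    linarith [Real.exp_one_lt_d9]
  have h6 : Real.log (6 * H) ≤ 6 * Real.log H := by
    rw [Real.log_mul (by norm_num) (by linarith)]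
    linarith [Real.log_le_sub_one_of_pos (show (0 : ℝ) < 6 by norm_num)]
  have h36 : Real.log (36 * H ^ 2) ≤ 12 * Real.log H := by
    rw [show 36 * H ^ 2 = (6 * H) ^ 2 by ring, Real.log_pow]
    push_cast; linarith
  have hR := sum_ite_abs_le_le (R := 6 * H) (by linarith)
  have hu : ∑ u ∈ (intBall (36 * H ^ 2)).erase 0, |(u : ℝ)|⁻¹ ≤ 26 * Real.log H :=
    calc _ ≤ ∑ u ∈ intBall (36 * H ^ 2), |(u : ℝ)|⁻¹ :=
          Finset.sum_le_sum_of_subset_of_nonneg (Finset.erase_subset _ _)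
            fun _ _ _ => by positivity
      _ ≤ _ := by linarith [sum_intBall_inv_le (R := 36 * H ^ 2) (by nlinarith)]
  calc _ ≤ ∑ u ∈ (intBall (36 * H ^ 2)).erase 0, ∑ v ∈ (intBall (6 * H)).erase 0,
      ∑ w ∈ (intBall (6 * H)).erase 0, 10000 * H ^ 2 * (|(u : ℝ)|⁻¹ *
      ((if |w| ≤ |v| then ((v : ℝ) ^ 2)⁻¹ else 0) +
        (if |v| ≤ |w| then ((w : ℝ) ^ 2)⁻¹ else 0))) :=
        Finset.sum_le_sum fun u hu => Finset.sum_le_sum fun v hv => Finset.sum_le_sum fun w hw =>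
          card_nearPairs_le (by linarith) (Finset.mem_erase.1 hu).1 (Finset.mem_erase.1 hv).1
            (Finset.mem_erase.1 hw).1
    _ = 10000 * H ^ 2 * ((∑ u ∈ (intBall (36 * H ^ 2)).erase 0, |(u : ℝ)|⁻¹) *
        (∑ v ∈ (intBall (6 * H)).erase 0, ∑ w ∈ (intBall (6 * H)).erase 0,
          (if |w| ≤ |v| then ((v : ℝ) ^ 2)⁻¹ else 0) +
        ∑ w ∈ (intBall (6 * H)).erase 0, ∑ v ∈ (intBall (6 * H)).erase 0,
          (if |v| ≤ |w| then ((w : ℝ) ^ 2)⁻¹ else 0))) := by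
        simp_rw [← Finset.mul_sum, Finset.sum_add_distrib]
        rw [← Finset.sum_mul]
        congr 3
        exact Finset.sum_comm
    _ ≤ 10000 * H ^ 2 * ((26 * Real.log H) * (42 * Real.log H + 42 * Real.log H)) := by
        gcongr <;> linarith
    _ ≤ _ := by nlinarith [mul_nonneg (sq_nonneg H) (sq_nonneg (Real.log H))]

theorem abs_resolvent_root_le {H a b c d x : ℝ} (hH : 1 ≤ H) (ha : |a| ≤ H) (hb : |b| ≤ H)
    (hc : |c| ≤ H) (hd : |d| ≤ H)
    (hx : x ^ 3 - b * x ^ 2 + (a * c - 4 * d) * x - (a ^ 2 * d - 4 * b * d + c ^ 2) = 0) :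
    |x| ≤ 4 * H := by
  have hH0 : 0 ≤ H := by linarith
  have hac : |a * c - 4 * d| ≤ 5 * H ^ 2 :=
    calc |a * c - 4 * d| ≤ |a * c| + |4 * d| := abs_sub _ _
      _ = |a| * |c| + 4 * |d| := by rw [abs_mul, abs_mul]; norm_num
      _ ≤ H * H + 4 * H := by gcongr
      _ ≤ _ := by nlinarith
  have hk : |a ^ 2 * d - 4 * b * d + c ^ 2| ≤ 6 * H ^ 3 :=
    calc |a ^ 2 * d - 4 * b * d + c ^ 2| ≤ |a ^ 2 * d| + |4 * b * d| + |c ^ 2| :=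
          (abs_add_le _ _).trans (add_le_add_left (abs_sub _ _) _)
      _ = |a| ^ 2 * |d| + 4 * |b| * |d| + |c| ^ 2 := by
          rw [abs_mul, abs_mul, abs_mul, abs_pow, abs_pow]; norm_num
      _ ≤ H ^ 2 * H + 4 * H * H + H ^ 2 := by gcongr
      _ ≤ _ := by nlinarith [mul_nonneg hH0 (mul_nonneg hH0 (sub_nonneg.2 hH))]
  have hx3 : |x| ^ 3 ≤ H * |x| ^ 2 + 5 * H ^ 2 * |x| + 6 * H ^ 3 :=
    calc |x| ^ 3 = |x ^ 3| := (abs_pow _ _).symm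
      _ = |b * x ^ 2 - (a * c - 4 * d) * x + (a ^ 2 * d - 4 * b * d + c ^ 2)| := by
          congr 1; linarith
      _ ≤ |b * x ^ 2| + |(a * c - 4 * d) * x| + |a ^ 2 * d - 4 * b * d + c ^ 2| :=
          (abs_add_le _ _).trans (add_le_add_left (abs_sub _ _) _)
      _ = |b| * |x| ^ 2 + |a * c - 4 * d| * |x| + |a ^ 2 * d - 4 * b * d + c ^ 2| := by
          rw [abs_mul, abs_mul, abs_pow]
      _ ≤ _ := by gcongr
  by_contra! hlt
  have h0 := abs_nonneg x
  generalize |x| = y at *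
  have h1 : 4 * H * y ^ 2 ≤ y ^ 3 := by nlinarith [sq_nonneg y]
  have h2 : 4 * H * (H * y) ≤ y * (H * y) := mul_le_mul_of_nonneg_right hlt.le (by positivity)
  have h3 : 4 * H * H ^ 2 < y * H ^ 2 := mul_lt_mul_of_pos_right hlt (by positivity)
  nlinarith

theorem exists_squarefree_mul_sq {A B C : ℤ} (hA : A ≠ 0) (h : A * B = C ^ 2) :
    ∃ u v w : ℤ, u ≠ 0 ∧ v ≠ 0 ∧ A = u * v ^ 2 ∧ B = u * w ^ 2 ∧ C = u * v * w := by
  obtain ⟨m, n, hmn, hm⟩ := Nat.sq_mul_squarefree A.natAbs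
  obtain ⟨u, v, hv, hu, hA'⟩ : ∃ u v : ℤ, v ≠ 0 ∧ Squarefree u ∧ A = u * v ^ 2 := by
    have habs : |A| = n ^ 2 * m := by
      rw [Int.abs_eq_natAbs, ← hmn]; push_cast; rfl
    have hn : (n : ℤ) ≠ 0 := by
      rintro h0
      rw [h0] at habs
      exact hA (by simpa using habs)
    rcases le_total 0 A with h0 | h0
    · refine ⟨m, n, hn, Int.squarefree_natCast.2 hm, ?_⟩
      rw [← abs_of_nonneg h0, habs]; ring
    · refine ⟨-m, n, hn, ?_, ?_⟩
      · rw [← Int.squarefree_natAbs, Int.natAbs_neg, Int.natAbs_natCast]; exact hm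
      · rw [abs_of_nonpos h0] at habs
        linarith
  subst hA'
  have hu0 : u ≠ 0 := hu.ne_zero
  have hvC : v ∣ C := by
    rw [← Int.pow_dvd_pow_iff (n := 2) two_ne_zero, ← h]
    exact ⟨u * B, by ring⟩
  obtain ⟨t, rfl⟩ := hvC
  have ht : u * B = t ^ 2 := by
    apply mul_left_cancel₀ (pow_ne_zero 2 hv)
    linarith
  have hut : u ∣ t := (hu.dvd_pow_iff_dvd two_ne_zero).1 ⟨B, ht.symm⟩
  obtain ⟨w, rfl⟩ := hut
  refine ⟨u, v, w, hu0, hv, rfl, ?_, by ring⟩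
  apply mul_left_cancel₀ hu0
  rw [ht]; ring

/-- The quadruples bounded by `H` whose cubic resolvent has an integral root. -/
def resolventQuadruples (H : ℝ) : Set (ℤ × ℤ × ℤ × ℤ) :=
  {p | |(p.1 : ℝ)| ≤ H ∧ |(p.2.1 : ℝ)| ≤ H ∧ |(p.2.2.1 : ℝ)| ≤ H ∧ |(p.2.2.2 : ℝ)| ≤ H ∧
    ∃ x : ℤ, x ^ 3 - p.2.1 * x ^ 2 + (p.1 * p.2.2.1 - 4 * p.2.2.2) * x -
      (p.1 ^ 2 * p.2.2.2 - 4 * p.2.1 * p.2.2.2 + p.2.2.1 ^ 2) = 0}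

theorem resolventQuadruples_subset {H : ℝ} (hH : 1 ≤ H) : resolventQuadruples H ⊆
    (((hyperbolaPairs H ×ˢ intBall H).image fun y =>
        (y.1.2, y.2, y.1.1 * y.1.2 / 2, y.1.1 ^ 2 / 4)) ∪
      ((hyperbolaPairs H ×ˢ intBall H).image fun y =>
        (y.1.2, (y.1.2 ^ 2 + 4 * y.1.1) / 4, y.1.1 * y.1.2 / 2, y.2)) ∪
      ((intBall (36 * H ^ 2)).erase 0).biUnion fun u => ((intBall (6 * H)).erase 0).biUnion
        fun v => ((intBall (6 * H)).erase 0).biUnion fun w => (nearPairs H u v w).image fun y =>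
          (y.2, (y.2 ^ 2 + 4 * y.1 - u * w ^ 2) / 4, (y.1 * y.2 - u * v * w) / 2,
            (y.1 ^ 2 - u * v ^ 2) / 4) : Finset (ℤ × ℤ × ℤ × ℤ)) := by
  rintro ⟨a, b, c, d⟩ ⟨ha, hb, hc, hd, x, hx⟩
  simp only at ha hb hc hd hx
  have hxH : |(x : ℝ)| ≤ 4 * H := abs_resolvent_root_le hH ha hb hc hd (by exact_mod_cast hx)
  have haH : |(a : ℝ)| ≤ 4 * H := by linarith
  have hkey : (x ^ 2 - 4 * d) * (a ^ 2 - 4 * b + 4 * x) = (x * a - 2 * c) ^ 2 := by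
    linear_combination 4 * hx
  have hP : x * a = 2 * c → (x, a) ∈ hyperbolaPairs H := fun h => by
    refine Finset.mem_filter.2 ⟨Finset.mem_product.2 ⟨mem_intBall.2 hxH, mem_intBall.2 haH⟩, ?_⟩
    have : (x : ℝ) * a = 2 * c := by exact_mod_cast h
    simp only [this, abs_mul, Nat.abs_ofNat]
    linarith
  rw [Finset.mem_coe, Finset.mem_union, Finset.mem_union]
  by_cases hA : x ^ 2 - 4 * d = 0
  · have hC : x * a = 2 * c := by
      rw [hA, zero_mul] at hkey
      exact sub_eq_zero.1 (pow_eq_zero_iff two_ne_zero |>.1 hkey.symm)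
    refine Or.inl (Or.inl (Finset.mem_image.2 ⟨((x, a), b),
      Finset.mem_product.2 ⟨hP hC, mem_intBall.2 hb⟩, ?_⟩))
    simp only [Prod.mk.injEq, true_and]
    constructor <;> omega
  by_cases hB : a ^ 2 - 4 * b + 4 * x = 0
  · have hC : x * a = 2 * c := by
      rw [hB, mul_zero] at hkey
      exact sub_eq_zero.1 (pow_eq_zero_iff two_ne_zero |>.1 hkey.symm)
    refine Or.inl (Or.inr (Finset.mem_image.2 ⟨((x, a), d),
      Finset.mem_product.2 ⟨hP hC, mem_intBall.2 hd⟩, ?_⟩))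
    simp only [Prod.mk.injEq, true_and, and_true]
    constructor <;> omega
  obtain ⟨u, v, w, hu, hv, hAu, hBu, hCu⟩ := exists_squarefree_mul_sq hA hkey
  have hw : w ≠ 0 := by
    rintro rfl
    exact hB (by rw [hBu]; ring)
  have h1 : |(x : ℝ) ^ 2 - u * v ^ 2| ≤ 20 * H := by
    have : (x : ℝ) ^ 2 - u * v ^ 2 = 4 * d := by
      have : x ^ 2 - u * v ^ 2 = 4 * d := by linarith
      exact_mod_cast this
    rw [this, abs_mul, Nat.abs_ofNat]; linarith
  have h2 : |(a : ℝ) ^ 2 - u * w ^ 2| ≤ 20 * H := by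
    have : (a : ℝ) ^ 2 - u * w ^ 2 = 4 * b - 4 * x := by
      have : a ^ 2 - u * w ^ 2 = 4 * b - 4 * x := by linarith
      exact_mod_cast this
    rw [this]
    rw [abs_le] at hb hxH ⊢
    constructor <;> linarith
  have h3 : |(x : ℝ) * a - u * v * w| ≤ 2 * H := by
    have : (x : ℝ) * a - u * v * w = 2 * c := by
      have : x * a - u * v * w = 2 * c := by linarith
      exact_mod_cast this
    rw [this, abs_mul, Nat.abs_ofNat]; linarith
  have hu1 : (1 : ℝ) ≤ |(u : ℝ)| := by exact_mod_cast Int.one_le_abs hu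
  have hv1 : (1 : ℝ) ≤ (v : ℝ) ^ 2 := by
    rw [← sq_abs]
    exact one_le_pow₀ (by exact_mod_cast Int.one_le_abs hv)
  have hbv := abs_mul_sq_le hH hxH h1
  have hbw := abs_mul_sq_le hH haH h2
  refine Or.inr ?_
  simp only [Finset.mem_biUnion, Finset.mem_erase, Finset.mem_image, mem_intBall]
  refine ⟨u, ⟨hu, by nlinarith⟩, v, ⟨hv, ?_⟩, w, ⟨hw, ?_⟩, (x, a), Finset.mem_filter.2
    ⟨Finset.mem_product.2 ⟨mem_intBall.2 hxH, mem_intBall.2 haH⟩, h1, h2, h3⟩, ?_⟩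
  · exact abs_le_of_sq_le_sq (by nlinarith) (by linarith)
  · exact abs_le_of_sq_le_sq (by nlinarith [sq_nonneg (w : ℝ)]) (by linarith)
  · simp only [Prod.mk.injEq, true_and]
    refine ⟨?_, ?_, ?_⟩ <;> omega

theorem ncard_resolventQuadruples_le {H : ℝ} (hH : 3 ≤ H) :
    ((resolventQuadruples H).ncard : ℝ) ≤ 23000000 * H ^ 2 * Real.log H ^ 2 := by
  have hL : 1 ≤ Real.log H := by
    rw [Real.le_log_iff_exp_le (by linarith)]
    linarith [Real.exp_one_lt_d9]
  have h1 := Set.ncard_le_ncard (resolventQuadruples_subset (H := H) (by linarith))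
    (Finset.finite_toSet _)
  rw [Set.ncard_coe_finset] at h1
  have hP := card_hyperbolaPairs_le hH
  have hb := card_intBall_le (R := H) (by linarith)
  have hPb : ((hyperbolaPairs H).card : ℝ) * (intBall H).card ≤ 60 * H * Real.log H * (3 * H) := by
    gcongr; linarith
  have hN := sum_card_nearPairs_le hH
  have h2 := h1.trans ((Finset.card_union_le _ _).trans (add_le_add ((Finset.card_union_le _ _).trans
    (add_le_add Finset.card_image_le Finset.card_image_le)) (Finset.card_biUnion_le.trans
      (Finset.sum_le_sum fun u _ => Finset.card_biUnion_le.trans (Finset.sum_le_sum fun v _ =>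
        Finset.card_biUnion_le.trans (Finset.sum_le_sum fun w _ => Finset.card_image_le))))))
  rw [Finset.card_product] at h2
  have h3 : ((resolventQuadruples H).ncard : ℝ) ≤
      (hyperbolaPairs H).card * (intBall H).card + (hyperbolaPairs H).card * (intBall H).card +
      ∑ u ∈ (intBall (36 * H ^ 2)).erase 0, ∑ v ∈ (intBall (6 * H)).erase 0,
      ∑ w ∈ (intBall (6 * H)).erase 0, ((nearPairs H u v w).card : ℝ) := by exact_mod_cast h2
  have h4 : H ^ 2 * Real.log H ≤ H ^ 2 * Real.log H ^ 2 := by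
    gcongr; nlinarith
  nlinarith

theorem not_isSquare_of_emod_three_eq_two {n : ℤ} (hn : n % 3 = 2) : ¬ IsSquare n := by
  rintro ⟨m, rfl⟩
  rw [Int.mul_emod] at hn
  have h1 := Int.emod_nonneg m (show (3 : ℤ) ≠ 0 by norm_num)
  have h2 := Int.emod_lt_of_pos m (show (0 : ℤ) < 3 by norm_num)
  interval_cases m % 3 <;> simp at hn

theorem dihedral_disc_emod_three {u p q r s : ℤ} (hu : u % 3 = 1) (hp : 3 ∣ p) (hq : 3 ∣ q)
    (hr : 3 ∣ r) (hs : s % 3 = 1) :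
    ((p ^ 2 + u * q ^ 2 - 4 * r) ^ 2 - u * (2 * p * q - 4 * s) ^ 2) % 3 = 2 := by
  obtain ⟨p, rfl⟩ := hp
  obtain ⟨q, rfl⟩ := hq
  obtain ⟨r, rfl⟩ := hr
  obtain ⟨k, rfl⟩ : ∃ k, u = 3 * k + 1 := ⟨u / 3, by omega⟩
  obtain ⟨l, rfl⟩ : ∃ l, s = 3 * l + 1 := ⟨s / 3, by omega⟩
  ring_nf
  omega

theorem eq_of_squarefree_mul_sq_eq {u v s t : ℕ} (hu : Squarefree u) (hv : Squarefree v)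
    (ht : t ≠ 0) (h : u * s ^ 2 = v * t ^ 2) : u = v := by
  have hsq : (u * s) ^ 2 = t ^ 2 * (u * v) := by linear_combination u * h
  have hdvd : t ∣ u * s := by
    rw [← Nat.pow_dvd_pow_iff (n := 2) two_ne_zero]
    exact ⟨_, hsq⟩
  obtain ⟨m, hm⟩ := hdvd
  have hm2 : m ^ 2 = u * v := by
    apply mul_left_cancel₀ (pow_ne_zero 2 ht)
    rw [← hsq, hm]; ring
  obtain ⟨k, rfl⟩ : u ∣ m := (hu.dvd_pow_iff_dvd two_ne_zero).1 ⟨v, hm2⟩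
  have hk : u * k ^ 2 = v := by
    apply mul_left_cancel₀ hu.ne_zero
    rw [← hm2]; ring
  have hk1 : IsUnit k := hv k ⟨u, by rw [← hk]; ring⟩
  rw [← hk, Nat.isUnit_iff.1 hk1]; ring

/-- The parameter `r` is determined by the quartic: twice it is the only integral root of the
cubic resolvent. -/
theorem dihedral_param_unique {u p q r s v q' r' t : ℤ}
    (hD : ¬ IsSquare ((p ^ 2 + u * q ^ 2 - 4 * r) ^ 2 - u * (2 * p * q - 4 * s) ^ 2))
    (hb : p ^ 2 - u * q ^ 2 + 2 * r = p ^ 2 - v * q' ^ 2 + 2 * r')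
    (hc : 2 * (p * r - u * q * s) = 2 * (p * r' - v * q' * t))
    (hd : r ^ 2 - u * s ^ 2 = r' ^ 2 - v * t ^ 2) : r = r' := by
  by_contra hne
  have hsub : r' - r ≠ 0 := sub_ne_zero.2 (Ne.symm hne)
  refine hD ⟨4 * r' + 2 * r - (p ^ 2 - u * q ^ 2 + 2 * r), ?_⟩
  apply mul_left_cancel₀ hsub
  have e1 : v * q' ^ 2 = u * q ^ 2 - 2 * r + 2 * r' := by linarith
  have e2 : v * t ^ 2 = r' ^ 2 - r ^ 2 + u * s ^ 2 := by linarith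
  have e3 : v * q' * t = p * r' - p * r + u * q * s := by linarith
  have e4 : (u * q ^ 2 - 2 * r + 2 * r') * (r' ^ 2 - r ^ 2 + u * s ^ 2) =
      (p * r' - p * r + u * q * s) ^ 2 := by
    rw [← e1, ← e2, ← e3]; ring
  linear_combination (-8) * e4

theorem dihedral_coeff_bounds {H t x δ ε k : ℝ} (hx : 0 ≤ x) (hxt : x ≤ t) (hδ : 0 ≤ δ)
    (hδk : δ ≤ 3 * k) (hε : 0 ≤ ε) (hεk : ε ≤ 3 * k) (hkt : k ≤ t) (hk : k * t ≤ H / 100)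
    (ht : t ≤ H / 100) :
    |2 * (x + δ)| ≤ H ∧ |(x + δ) ^ 2 - x ^ 2 + 2 * (t + ε)| ≤ H ∧
      |2 * ((x + δ) * (t + ε) - x * t)| ≤ H ∧ |(t + ε) ^ 2 - t ^ 2| ≤ H := by
  have ht0 : 0 ≤ t := hx.trans hxt
  have hk0 : 0 ≤ k := by linarith
  have e1 : δ * x ≤ 3 * k * t := mul_le_mul hδk hxt hx (by linarith)
  have e2 : ε * t ≤ 3 * k * t := mul_le_mul_of_nonneg_right hεk ht0
  have e3 : δ * δ ≤ 3 * k * (3 * t) := mul_le_mul hδk (by linarith) hδ (by linarith)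
  have e4 : ε * ε ≤ 3 * k * (3 * t) := mul_le_mul hεk (by linarith) hε (by linarith)
  have e5 : δ * ε ≤ 3 * k * (3 * t) := mul_le_mul hδk (by linarith) hε (by linarith)
  have e6 : δ * t ≤ 3 * k * t := mul_le_mul_of_nonneg_right hδk ht0
  have e7 : ε * x ≤ 3 * k * t := mul_le_mul hεk hxt hx (by linarith)
  have f1 := mul_nonneg hδ hx
  have f2 := mul_nonneg hε ht0
  have f3 := mul_nonneg hδ hδ
  have f4 := mul_nonneg hε hε
  have f5 := mul_nonneg hδ hε
  have f6 := mul_nonneg hδ ht0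
  have f7 := mul_nonneg hε hx
  refine ⟨?_, ?_, ?_, ?_⟩ <;> rw [abs_le] <;> constructor <;> nlinarith

/-- The least multiple of three exceeding `3x`, shifted by `3i`. -/
noncomputable def tripleAbove (x : ℝ) (i : ℕ) : ℕ := 3 * (⌊x⌋₊ + 1 + i)

theorem tripleAbove_sub {x : ℝ} (hx : 0 ≤ x) {i k : ℕ} (hi : i < k) :
    0 ≤ (tripleAbove x i : ℝ) - 3 * x ∧ (tripleAbove x i : ℝ) - 3 * x ≤ 3 * k := by
  have h1 := Nat.floor_le hx
  have h2 := Nat.lt_floor_add_one x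
  have h3 : (i : ℝ) + 1 ≤ k := by exact_mod_cast hi
  have h4 : (0 : ℝ) ≤ i := Nat.cast_nonneg i
  rw [tripleAbove]
  push_cast
  constructor <;> linarith

theorem tripleAbove_injective (x : ℝ) : Function.Injective (tripleAbove x) := by
  intro i j h
  simp only [tripleAbove] at h
  omega

/-- The coefficients of `(X² + pX + r)² - u(qX + s)²`. -/
def normQuartic (u p q r s : ℤ) : ℤ × ℤ × ℤ × ℤ :=
  (2 * p, p ^ 2 - u * q ^ 2 + 2 * r, 2 * (p * r - u * q * s), r ^ 2 - u * s ^ 2)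

/-- The number of admissible shifts in the family of quartics below. -/
noncomputable def shiftCount (n u l : ℕ) : ℕ := ⌊(n : ℝ) ^ 8 / 100 / (√u * (3 * l + 1))⌋₊

/-- A parametrised family of quartics with dihedral Galois group. -/
noncomputable def dihedralFamily (y : (_ : ℕ × ℕ) × (ℕ × ℕ × ℕ)) : ℤ × ℤ × ℤ × ℤ :=
  normQuartic y.1.1 (tripleAbove (√y.1.1 * y.2.1) y.2.2.1) (3 * y.2.1 : ℕ)
    (tripleAbove (√y.1.1 * (3 * y.1.2 + 1) / 3) y.2.2.2) (3 * y.1.2 + 1 : ℕ)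

/-- The squarefree integers in `(1, N]` congruent to one modulo three. -/
def squarefreeModThree (N : ℕ) : Finset ℕ :=
  (Finset.Ioc 1 N).filter fun u => Squarefree u ∧ u % 3 = 1

/-- The parameters of the members of `dihedralFamily` which are bounded by `n ^ 8`. -/
noncomputable def dihedralParams (n : ℕ) : Finset ((_ : ℕ × ℕ) × (ℕ × ℕ × ℕ)) :=
  (squarefreeModThree (n ^ 4) ×ˢ Finset.Ico (n ^ 4) (n ^ 5)).sigma fun y =>
    Finset.range (y.2 + 1) ×ˢ
      (Finset.range (shiftCount n y.1 y.2) ×ˢ Finset.range (shiftCount n y.1 y.2))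

theorem mem_dihedralParams {n u l m i j : ℕ} :
    (⟨(u, l), (m, i, j)⟩ : (_ : ℕ × ℕ) × (ℕ × ℕ × ℕ)) ∈ dihedralParams n ↔
      ((((1 < u ∧ u ≤ n ^ 4) ∧ Squarefree u ∧ u % 3 = 1) ∧ n ^ 4 ≤ l ∧ l < n ^ 5) ∧ m < l + 1 ∧
        i < shiftCount n u l ∧ j < shiftCount n u l) := by
  simp [dihedralParams, squarefreeModThree]

theorem dihedralFamily_injOn (n : ℕ) : Set.InjOn dihedralFamily (dihedralParams n) := by
  rintro ⟨⟨u, l⟩, m, i, j⟩ hy ⟨⟨u', l'⟩, m', i', j'⟩ hy' h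
  rw [Finset.mem_coe, mem_dihedralParams] at hy hy'
  obtain ⟨⟨⟨⟨hu1, -⟩, husq, hu3⟩, -⟩, -⟩ := hy
  obtain ⟨⟨⟨⟨hu1', -⟩, husq', hu3'⟩, -⟩, -⟩ := hy'
  simp only [dihedralFamily, normQuartic, Prod.mk.injEq] at h
  obtain ⟨ha, hb, hc, hd⟩ := h
  have hp : tripleAbove (√u * m) i = tripleAbove (√u' * m') i' := by
    have := mul_left_cancel₀ two_ne_zero ha
    exact_mod_cast this
  rw [← hp] at hb hc
  have hD := not_isSquare_of_emod_three_eq_two (dihedral_disc_emod_three (u := u)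
    (p := tripleAbove (√u * m) i) (q := (3 * m : ℕ))
    (r := tripleAbove (√u * (3 * l + 1) / 3) j) (s := (3 * l + 1 : ℕ)) (by omega)
    (by exact_mod_cast Dvd.intro _ rfl) (by exact_mod_cast Dvd.intro _ rfl)
    (by exact_mod_cast Dvd.intro _ rfl) (by omega))
  have hr := dihedral_param_unique hD hb hc hd
  rw [← hr] at hb hd
  have hus : u * (3 * l + 1) ^ 2 = u' * (3 * l' + 1) ^ 2 := by
    have : (u : ℤ) * ((3 * l + 1 : ℕ) : ℤ) ^ 2 = u' * ((3 * l' + 1 : ℕ) : ℤ) ^ 2 := by linarith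
    exact_mod_cast this
  obtain rfl := eq_of_squarefree_mul_sq_eq husq husq' (by omega) hus
  have hu0 : u ≠ 0 := by omega
  have hl : l = l' := by
    have := Nat.pow_left_injective two_ne_zero (mul_left_cancel₀ hu0 hus)
    simpa using this
  subst hl
  have hm : m = m' := by
    have huq : (u : ℤ) * ((3 * m : ℕ) : ℤ) ^ 2 = u * ((3 * m' : ℕ) : ℤ) ^ 2 := by linarith
    have huq' : u * (3 * m) ^ 2 = u * (3 * m') ^ 2 := by exact_mod_cast huq
    have := Nat.pow_left_injective two_ne_zero (mul_left_cancel₀ hu0 huq')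
    simpa using this
  subst hm
  obtain rfl := tripleAbove_injective _ hp
  obtain rfl := tripleAbove_injective _ (by exact_mod_cast hr)
  rfl

theorem abs_dihedralFamily_le {n : ℕ} (hn : 300 ≤ n) {y : (_ : ℕ × ℕ) × (ℕ × ℕ × ℕ)}
    (hy : y ∈ dihedralParams n) :
    |((dihedralFamily y).1 : ℝ)| ≤ (n : ℝ) ^ 8 ∧ |((dihedralFamily y).2.1 : ℝ)| ≤ (n : ℝ) ^ 8 ∧
    |((dihedralFamily y).2.2.1 : ℝ)| ≤ (n : ℝ) ^ 8 ∧
    |((dihedralFamily y).2.2.2 : ℝ)| ≤ (n : ℝ) ^ 8 := by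
  obtain ⟨⟨u, l⟩, m, i, j⟩ := y
  obtain ⟨⟨⟨⟨hu1, hun⟩, husq, hu3⟩, hl1, hl2⟩, hm, hi, hj⟩ := mem_dihedralParams.1 hy
  have hn' : (300 : ℝ) ≤ n := by exact_mod_cast hn
  have hu1' : (1 : ℝ) < u := by exact_mod_cast hu1
  have hsq : √(u : ℝ) ^ 2 = u := Real.sq_sqrt (by linarith)
  have hsq1 : 1 ≤ √(u : ℝ) := Real.one_le_sqrt.2 hu1'.le
  have hsqn : √(u : ℝ) ≤ (n : ℝ) ^ 2 := by
    rw [Real.sqrt_le_left (by positivity), ← pow_mul]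
    exact_mod_cast hun
  have hl1' : (n : ℝ) ^ 4 ≤ l := by exact_mod_cast hl1
  have hl2' : (l : ℝ) + 1 ≤ (n : ℝ) ^ 5 := by exact_mod_cast hl2
  have hm' : (m : ℝ) ≤ l := by exact_mod_cast Nat.lt_succ_iff.1 hm
  have hm0 : (0 : ℝ) ≤ m := Nat.cast_nonneg m
  have hl0 : (0 : ℝ) ≤ l := Nat.cast_nonneg l
  obtain ⟨t, ht⟩ : ∃ t, t = √(u : ℝ) * (3 * l + 1) := ⟨_, rfl⟩
  have htpos : 0 < t := by rw [ht]; positivity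
  have hlow : (n : ℝ) ^ 4 ≤ t := by rw [ht]; nlinarith
  have hhigh : t ≤ (n : ℝ) ^ 8 / 100 :=
    calc t ≤ (n : ℝ) ^ 2 * (3 * (n : ℝ) ^ 5) := by
          rw [ht]; gcongr; linarith
      _ = 3 * (n : ℝ) ^ 7 := by ring
      _ ≤ n / 100 * (n : ℝ) ^ 7 := by gcongr; linarith
      _ = _ := by ring
  have hKt : (shiftCount n u l : ℝ) * t ≤ (n : ℝ) ^ 8 / 100 := by
    have := Nat.floor_le (a := (n : ℝ) ^ 8 / 100 / (√(u : ℝ) * (3 * l + 1))) (by positivity)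
    rw [← ht] at this
    rw [shiftCount, ← ht]
    calc _ ≤ (n : ℝ) ^ 8 / 100 / t * t := by gcongr
      _ = _ := by field_simp
  have hK : (shiftCount n u l : ℝ) ≤ t := by
    have : (n : ℝ) ^ 8 ≤ t * t :=
      calc (n : ℝ) ^ 8 = (n : ℝ) ^ 4 * (n : ℝ) ^ 4 := by ring
        _ ≤ _ := by gcongr
    refine le_of_mul_le_mul_right ?_ htpos
    have : (0 : ℝ) ≤ (n : ℝ) ^ 8 := by positivity
    linarith
  have hp := tripleAbove_sub (x := √(u : ℝ) * m) (by positivity) hi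
  have hr := tripleAbove_sub (x := t / 3) (by positivity) hj
  obtain ⟨h1, h2, h3, h4⟩ := dihedral_coeff_bounds (x := 3 * (√(u : ℝ) * m)) (by positivity)
    (by rw [ht]; nlinarith) hp.1 hp.2 hr.1 hr.2 hK hKt hhigh
  have ep : 3 * (√(u : ℝ) * m) + (tripleAbove (√(u : ℝ) * m) i - 3 * (√(u : ℝ) * m)) =
    tripleAbove (√(u : ℝ) * m) i := by ring
  have er : t + (tripleAbove (t / 3) j - 3 * (t / 3)) = tripleAbove (t / 3) j := by ring
  have ex : (3 * (√(u : ℝ) * m)) ^ 2 = u * (3 * m) ^ 2 := by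
    linear_combination (9 * (m : ℝ) ^ 2) * hsq
  have et : t ^ 2 = u * (3 * l + 1) ^ 2 := by rw [ht, mul_pow, hsq]
  have ext : 3 * (√(u : ℝ) * m) * t = u * (3 * m) * (3 * l + 1) := by
    rw [ht]; linear_combination (3 * m * (3 * l + 1)) * hsq
  rw [ep] at h1 h2 h3
  rw [er] at h2 h3 h4
  rw [ex] at h2
  rw [ext] at h3
  rw [et] at h4
  simp only [dihedralFamily, normQuartic, ← ht]
  refine ⟨by push_cast; exact h1, by push_cast; exact h2, by push_cast; exact h3,
    by push_cast; exact h4⟩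

theorem dihedralFamily_gal {n : ℕ} {y : (_ : ℕ × ℕ) × (ℕ × ℕ × ℕ)} (hy : y ∈ dihedralParams n) :
    Irreducible (quartic (dihedralFamily y).1 (dihedralFamily y).2.1 (dihedralFamily y).2.2.1
      (dihedralFamily y).2.2.2) ∧
    Nonempty ((quartic (dihedralFamily y).1 (dihedralFamily y).2.1 (dihedralFamily y).2.2.1
      (dihedralFamily y).2.2.2).Gal ≃* DihedralGroup 4) := by
  obtain ⟨⟨u, l⟩, m, i, j⟩ := y
  obtain ⟨⟨⟨⟨hu1, -⟩, husq, hu3⟩, -⟩, -⟩ := mem_dihedralParams.1 hy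
  have hmod := dihedral_disc_emod_three (u := u)
    (p := tripleAbove (√u * m) i) (q := (3 * m : ℕ))
    (r := tripleAbove (√u * (3 * l + 1) / 3) j) (s := (3 * l + 1 : ℕ)) (by omega)
    (by exact_mod_cast Dvd.intro _ rfl) (by exact_mod_cast Dvd.intro _ rfl)
    (by exact_mod_cast Dvd.intro _ rfl) (by omega)
  refine quartic_dihedral (Int.natCast_ne_zero.2 (Nat.succ_ne_zero _)) rfl rfl rfl rfl rfl ?_
    (not_isSquare_of_emod_three_eq_two hmod) (not_isSquare_of_emod_three_eq_two ?_)
  · rintro ⟨v, hv⟩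
    have hv' : u = v.natAbs * v.natAbs := by
      rw [← Int.natAbs_mul, ← hv, Int.natAbs_natCast]
    have := Nat.isUnit_iff.1 (husq v.natAbs ⟨1, by rw [mul_one]; exact hv'⟩)
    rw [this] at hv'
    omega
  · change ((u : ℤ) * _) % 3 = 2
    rw [Int.mul_emod, hmod]
    omega

theorem half_log_le_sum_inv {n : ℕ} (hn : 0 < n) (hL : 2 ≤ Real.log n) :
    Real.log n / 2 ≤ ∑ l ∈ Finset.Ico (n ^ 4) (n ^ 5), ((l : ℝ) + 1)⁻¹ := by
  have hle : n ^ 4 ≤ n ^ 5 := Nat.pow_le_pow_right hn (by norm_num)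
  have h1 := log_add_one_le_harmonic (n ^ 5)
  have h2 := harmonic_le_one_add_log (n ^ 4)
  rw [harmonic] at h1 h2
  push_cast at h1 h2
  have h3 := Finset.sum_range_add_sum_Ico (fun l : ℕ => ((l : ℝ) + 1)⁻¹) hle
  have h4 : 5 * Real.log n ≤ Real.log ((n : ℝ) ^ 5 + 1) := by
    rw [show 5 * Real.log n = Real.log ((n : ℝ) ^ 5) by rw [Real.log_pow]; norm_num]
    exact Real.log_le_log (by positivity) (by linarith)
  rw [Real.log_pow] at h2
  push_cast at h2
  linarith

theorem sum_inv_le_two_mul_sum_squarefree (N : ℕ) :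
    ∑ x ∈ (Finset.Icc 1 N).filter (fun x => x % 3 = 1), (x : ℝ)⁻¹ ≤
      2 * (1 + ∑ u ∈ squarefreeModThree N, (u : ℝ)⁻¹) := by
  have hsub : (Finset.Icc 1 N).filter (fun x => x % 3 = 1) ⊆
      ((insert 1 (squarefreeModThree N)) ×ˢ Finset.Ioo 0 (N + 1)).image
        fun y : ℕ × ℕ => y.1 * y.2 ^ 2 := by
    intro x hx
    obtain ⟨hx, hx3⟩ := Finset.mem_filter.1 hx
    rw [Finset.mem_Icc] at hx
    obtain ⟨k, m, hkm, hk⟩ := Nat.sq_mul_squarefree x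
    have hm0 : 0 < m := by
      rcases Nat.eq_zero_or_pos m with rfl | h
      · simp at hkm; omega
      · exact h
    have hk0 : 0 < k := Nat.pos_of_ne_zero hk.ne_zero
    have hmx : m ≤ x := by rw [← hkm]; nlinarith [Nat.mul_pos hm0 hk0]
    have hkx : k ≤ x := by rw [← hkm]; nlinarith [Nat.mul_pos hm0 hm0]
    have hk3 : k % 3 = 1 := by
      rw [← hkm, Nat.mul_mod, Nat.pow_mod] at hx3
      have h1 := Nat.mod_lt m (show 0 < 3 by norm_num)
      have h2 := Nat.mod_lt k (show 0 < 3 by norm_num)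
      interval_cases m % 3 <;> interval_cases k % 3 <;> simp at hx3 ⊢
    refine Finset.mem_image.2 ⟨(k, m), Finset.mem_product.2 ⟨?_, ?_⟩, by rw [mul_comm]; exact hkm⟩
    · rw [Finset.mem_insert, squarefreeModThree, Finset.mem_filter, Finset.mem_Ioc]
      rcases Nat.lt_or_ge 1 k with h | h
      · exact Or.inr ⟨⟨h, hkx.trans hx.2⟩, hk, hk3⟩
      · exact Or.inl (le_antisymm h hk0)
    · exact Finset.mem_Ioo.2 ⟨hm0, by simp only; omega⟩
  have hsq := sum_Ioo_inv_sq_le (α := ℝ) 0 (N + 1)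
  have h1 : (1 : ℕ) ∉ squarefreeModThree N := by simp [squarefreeModThree]
  calc _ ≤ ∑ x ∈ ((insert 1 (squarefreeModThree N)) ×ˢ Finset.Ioo 0 (N + 1)).image
        (fun y : ℕ × ℕ => y.1 * y.2 ^ 2), (x : ℝ)⁻¹ :=
        Finset.sum_le_sum_of_subset_of_nonneg hsub fun _ _ _ => by positivity
    _ ≤ ∑ y ∈ (insert 1 (squarefreeModThree N)) ×ˢ Finset.Ioo 0 (N + 1),
        (((y.1 * y.2 ^ 2 : ℕ) : ℝ))⁻¹ :=
        Finset.sum_image_le_of_nonneg fun _ _ => by positivity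
    _ = (∑ u ∈ insert 1 (squarefreeModThree N), (u : ℝ)⁻¹) *
        ∑ m ∈ Finset.Ioo 0 (N + 1), ((m : ℝ) ^ 2)⁻¹ := by
        rw [Finset.sum_mul_sum, Finset.sum_product]
        simp [mul_comm]
    _ ≤ (∑ u ∈ insert 1 (squarefreeModThree N), (u : ℝ)⁻¹) * 2 := by
        gcongr
        simpa using hsq
    _ = _ := by
        rw [Finset.sum_insert h1]
        simp [mul_comm]

theorem quarter_log_le_sum_squarefree {n : ℕ} (hn : 3 ≤ n) (hL : 4 ≤ Real.log n) :
    Real.log n / 4 ≤ ∑ u ∈ squarefreeModThree (n ^ 4), (u : ℝ)⁻¹ := by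
  have h1 := sum_inv_le_two_mul_sum_squarefree (n ^ 4)
  have h2 : Real.log n ≤
      ∑ x ∈ (Finset.Icc 1 (n ^ 4)).filter (fun x => x % 3 = 1), (x : ℝ)⁻¹ := by
    have hinj : Set.InjOn (fun l : ℕ => 3 * l + 1) (Finset.range (n ^ 3) : Set ℕ) := by
      intro x _ y _ h
      simpa using h
    have h3 := log_add_one_le_harmonic (n ^ 3)
    rw [harmonic] at h3
    push_cast at h3
    have h4 : 3 * Real.log n ≤ Real.log ((n : ℝ) ^ 3 + 1) := by
      rw [show 3 * Real.log n = Real.log ((n : ℝ) ^ 3) by rw [Real.log_pow]; norm_num]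
      exact Real.log_le_log (by positivity) (by linarith)
    calc Real.log n ≤ (∑ l ∈ Finset.range (n ^ 3), ((l : ℝ) + 1)⁻¹) / 3 := by linarith
      _ = ∑ l ∈ Finset.range (n ^ 3), ((l : ℝ) + 1)⁻¹ / 3 := Finset.sum_div _ _ _
      _ ≤ ∑ l ∈ Finset.range (n ^ 3), (((3 * l + 1 : ℕ)) : ℝ)⁻¹ := by
          refine Finset.sum_le_sum fun l _ => ?_
          rw [div_eq_mul_inv, ← mul_inv]
          apply inv_anti₀ (by positivity)
          push_cast
          linarith
      _ = ∑ x ∈ (Finset.range (n ^ 3)).image (fun l : ℕ => 3 * l + 1), ((x : ℕ) : ℝ)⁻¹ :=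
          (Finset.sum_image (f := fun x : ℕ => (x : ℝ)⁻¹) hinj).symm
      _ ≤ _ := by
          refine Finset.sum_le_sum_of_subset_of_nonneg ?_ fun _ _ _ => by positivity
          intro x hx
          obtain ⟨l, hl, rfl⟩ := Finset.mem_image.1 hx
          have hl' := Finset.mem_range.1 hl
          have : 3 * n ^ 3 ≤ n ^ 4 := by rw [pow_succ' n 3]; gcongr
          rw [Finset.mem_filter, Finset.mem_Icc]
          omega
  linarith

theorem le_shiftCount {n u l : ℕ} (hn : 300 ≤ n) (hu1 : 0 < u) (hun : u ≤ n ^ 4)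
    (hl : l < n ^ 5) :
    (n : ℝ) ^ 8 / (600 * (√u * (l + 1))) ≤ shiftCount n u l := by
  have hn' : (300 : ℝ) ≤ n := by exact_mod_cast hn
  have hsq0 : 0 < √(u : ℝ) := Real.sqrt_pos.2 (by exact_mod_cast hu1)
  have hsqn : √(u : ℝ) ≤ (n : ℝ) ^ 2 := by
    rw [Real.sqrt_le_left (by positivity), ← pow_mul]
    exact_mod_cast hun
  have hl' : (l : ℝ) + 1 ≤ (n : ℝ) ^ 5 := by exact_mod_cast hl
  have hl0 : (0 : ℝ) ≤ l := Nat.cast_nonneg l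
  have ht0 : 0 < √(u : ℝ) * (3 * l + 1) := by positivity
  have hhigh : √(u : ℝ) * (3 * l + 1) ≤ (n : ℝ) ^ 8 / 100 :=
    calc _ ≤ (n : ℝ) ^ 2 * (3 * (n : ℝ) ^ 5) := by gcongr; linarith
      _ = 3 * (n : ℝ) ^ 7 := by ring
      _ ≤ n / 100 * (n : ℝ) ^ 7 := by gcongr; linarith
      _ = _ := by ring
  have h1 : 1 ≤ (n : ℝ) ^ 8 / 100 / (√(u : ℝ) * (3 * l + 1)) := (one_le_div ht0).2 hhigh
  have h2 := Nat.lt_floor_add_one ((n : ℝ) ^ 8 / 100 / (√(u : ℝ) * (3 * l + 1)))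
  have h3 : (1 : ℝ) ≤ ⌊(n : ℝ) ^ 8 / 100 / (√(u : ℝ) * (3 * l + 1))⌋₊ := by
    exact_mod_cast Nat.one_le_floor_iff _ |>.2 h1
  have h4 : (n : ℝ) ^ 8 / (600 * (√u * (l + 1))) ≤
      (n : ℝ) ^ 8 / 100 / (√(u : ℝ) * (3 * l + 1)) / 2 := by
    rw [div_div, div_div]
    apply div_le_div_of_nonneg_left (by positivity) (by positivity)
    nlinarith
  rw [shiftCount]
  linarith

theorem card_dihedralParams_ge {n : ℕ} (hn : 300 ≤ n) :
    (n : ℝ) ^ 16 * Real.log n ^ 2 / 2880000 ≤ (dihedralParams n).card := by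
  have hL : 4 ≤ Real.log n := by
    rw [Real.le_log_iff_exp_le (by positivity)]
    have h1 : Real.exp 4 = Real.exp 1 ^ 4 := by rw [← Real.exp_nat_mul]; norm_num
    have h2 : Real.exp 1 ^ 4 ≤ 3 ^ 4 :=
      pow_le_pow_left₀ (Real.exp_pos 1).le (by linarith [Real.exp_one_lt_d9]) 4
    have h3 : (300 : ℝ) ≤ n := by exact_mod_cast hn
    linarith
  have hU := quarter_log_le_sum_squarefree (n := n) (by omega) hL
  have hS := half_log_le_sum_inv (n := n) (by omega) (by linarith)
  rw [dihedralParams, Finset.card_sigma]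
  simp only [Finset.card_product, Finset.card_range]
  push_cast
  calc (n : ℝ) ^ 16 * Real.log n ^ 2 / 2880000 =
        (n : ℝ) ^ 16 / 360000 * ((Real.log n / 4) * (Real.log n / 2)) := by ring
    _ ≤ (n : ℝ) ^ 16 / 360000 * ((∑ u ∈ squarefreeModThree (n ^ 4), (u : ℝ)⁻¹) *
        ∑ l ∈ Finset.Ico (n ^ 4) (n ^ 5), ((l : ℝ) + 1)⁻¹) := by
        gcongr
    _ = ∑ y ∈ squarefreeModThree (n ^ 4) ×ˢ Finset.Ico (n ^ 4) (n ^ 5),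
        (n : ℝ) ^ 16 / 360000 * ((y.1 : ℝ)⁻¹ * ((y.2 : ℝ) + 1)⁻¹) := by
        rw [Finset.sum_mul_sum, ← Finset.sum_product', Finset.mul_sum]
    _ ≤ _ := by
        refine Finset.sum_le_sum fun y hy => ?_
        obtain ⟨hu, hl⟩ := Finset.mem_product.1 hy
        obtain ⟨hu1, hun⟩ := Finset.mem_Ioc.1 (Finset.mem_filter.1 hu).1
        have h := le_shiftCount hn (by omega) hun (Finset.mem_Ico.1 hl).2
        have hu0 : (0 : ℝ) < y.1 := by exact_mod_cast (by omega : 0 < y.1)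
        have hsq0 : 0 < √(y.1 : ℝ) := Real.sqrt_pos.2 hu0
        have hsq : √(y.1 : ℝ) ^ 2 = y.1 := Real.sq_sqrt hu0.le
        have hl0 : (0 : ℝ) < (y.2 : ℝ) + 1 := by positivity
        calc _ = ((y.2 : ℝ) + 1) * (((n : ℝ) ^ 8 / (600 * (√(y.1 : ℝ) * (y.2 + 1)))) *
              ((n : ℝ) ^ 8 / (600 * (√(y.1 : ℝ) * (y.2 + 1))))) := by
              rw [← hsq]; field_simp; norm_num
          _ ≤ _ := by gcongr

theorem finite_bounded_quadruples (H : ℝ) : {p : ℤ × ℤ × ℤ × ℤ |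
    |(p.1 : ℝ)| ≤ H ∧ |(p.2.1 : ℝ)| ≤ H ∧ |(p.2.2.1 : ℝ)| ≤ H ∧ |(p.2.2.2 : ℝ)| ≤ H}.Finite := by
  refine (Finset.finite_toSet (intBall H ×ˢ intBall H ×ˢ intBall H ×ˢ intBall H)).subset ?_
  rintro ⟨a, b, c, d⟩ ⟨ha, hb, hc, hd⟩
  simpa [mem_intBall] using ⟨ha, hb, hc, hd⟩

/-- The quadruples counted by `quarticGalCount (DihedralGroup 4) H`. -/
def dihedralQuadruples (H : ℝ) : Set (ℤ × ℤ × ℤ × ℤ) :=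
  {p | |(p.1 : ℝ)| ≤ H ∧ |(p.2.1 : ℝ)| ≤ H ∧ |(p.2.2.1 : ℝ)| ≤ H ∧ |(p.2.2.2 : ℝ)| ≤ H ∧
    Irreducible (quartic p.1 p.2.1 p.2.2.1 p.2.2.2) ∧
    Nonempty ((quartic p.1 p.2.1 p.2.2.1 p.2.2.2).Gal ≃* DihedralGroup 4)}

theorem finite_dihedralQuadruples (H : ℝ) : (dihedralQuadruples H).Finite :=
  (finite_bounded_quadruples H).subset fun _ hp => ⟨hp.1, hp.2.1, hp.2.2.1, hp.2.2.2.1⟩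

theorem ncard_dihedralQuadruples_le {H : ℝ} (hH : 3 ≤ H) :
    ((dihedralQuadruples H).ncard : ℝ) ≤ 23000000 * H ^ 2 * Real.log H ^ 2 := by
  refine le_trans ?_ (ncard_resolventQuadruples_le hH)
  refine Nat.cast_le.2 (Set.ncard_le_ncard ?_ ((finite_bounded_quadruples H).subset
    fun _ hp => ⟨hp.1, hp.2.1, hp.2.2.1, hp.2.2.2.1⟩))
  rintro p ⟨ha, hb, hc, hd, hirr, ⟨e⟩⟩
  refine ⟨ha, hb, hc, hd, exists_resolvent_root hirr ?_⟩
  rw [Nat.card_congr e.toEquiv, DihedralGroup.nat_card]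

theorem le_ncard_dihedralQuadruples_pow {n : ℕ} (hn : 300 ≤ n) :
    (n : ℝ) ^ 16 * Real.log n ^ 2 / 2880000 ≤ (dihedralQuadruples ((n : ℝ) ^ 8)).ncard := by
  refine (card_dihedralParams_ge hn).trans (Nat.cast_le.2 ?_)
  rw [← Finset.card_image_of_injOn (dihedralFamily_injOn n), ← Set.ncard_coe_finset]
  refine Set.ncard_le_ncard ?_ (finite_dihedralQuadruples _)
  intro p hp
  obtain ⟨y, hy, rfl⟩ := Finset.mem_image.1 hp
  obtain ⟨h1, h2, h3, h4⟩ := abs_dihedralFamily_le hn hy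
  exact ⟨h1, h2, h3, h4, dihedralFamily_gal hy⟩

theorem one_le_ncard_dihedralQuadruples {H : ℝ} (hH : 3 ≤ H) :
    1 ≤ (dihedralQuadruples H).ncard := by
  refine (Set.ncard_pos (finite_dihedralQuadruples H)).2 ⟨(0, 0, 0, -2), ?_, ?_, ?_, ?_, ?_⟩
  · simp; linarith
  · simp; linarith
  · simp; linarith
  · simp; linarith
  · refine quartic_dihedral (u := 2) (p := 0) (q := 0) (r := 0) (s := 1) (D := -32) one_ne_zero
      (by norm_num) (by norm_num) (by norm_num) (by norm_num) (by norm_num) ?_ ?_ ?_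
    · exact not_isSquare_of_emod_three_eq_two (by norm_num)
    · rintro ⟨m, hm⟩
      nlinarith [mul_self_nonneg m]
    · rintro ⟨m, hm⟩
      nlinarith [mul_self_nonneg m]

theorem dihedralQuadruples_mono {H K : ℝ} (h : H ≤ K) :
    dihedralQuadruples H ⊆ dihedralQuadruples K := fun _ hp =>
  ⟨hp.1.trans h, hp.2.1.trans h, hp.2.2.1.trans h, hp.2.2.2.1.trans h, hp.2.2.2.2⟩

theorem exists_nat_pow_eight {H : ℝ} (hH : 300 ^ 8 ≤ H) :
    ∃ n : ℕ, 300 ≤ n ∧ (n : ℝ) ^ 8 ≤ H ∧ H ≤ 256 * (n : ℝ) ^ 8 := by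
  have hH0 : 0 ≤ H := le_trans (by positivity) hH
  obtain ⟨x, hx0, hx⟩ : ∃ x : ℝ, 0 ≤ x ∧ x ^ 8 = H :=
    ⟨H ^ (8⁻¹ : ℝ), Real.rpow_nonneg hH0 _, by
      rw [← Real.rpow_natCast, ← Real.rpow_mul hH0]; norm_num⟩
  have hx300 : 300 ≤ x := le_of_pow_le_pow_left₀ (by norm_num : 8 ≠ 0) hx0 (by rw [hx]; exact hH)
  have h1 := Nat.floor_le hx0
  have h2 := Nat.lt_floor_add_one x
  have hn : 300 ≤ ⌊x⌋₊ := Nat.le_floor (by exact_mod_cast hx300)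
  have hn' : (300 : ℝ) ≤ ⌊x⌋₊ := by exact_mod_cast hn
  refine ⟨⌊x⌋₊, hn, ?_, ?_⟩
  · rw [← hx]
    exact pow_le_pow_left₀ (Nat.cast_nonneg _) h1 8
  · rw [← hx]
    calc x ^ 8 ≤ (2 * (⌊x⌋₊ : ℝ)) ^ 8 := pow_le_pow_left₀ hx0 (by linarith) 8
      _ = _ := by ring

theorem le_ncard_dihedralQuadruples : ∃ c : ℝ, 0 < c ∧ ∀ H : ℝ, 3 ≤ H →
    c * H ^ 2 * Real.log H ^ 2 ≤ (dihedralQuadruples H).ncard := by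
  have hB : (0 : ℝ) < Real.log (300 ^ 8) := Real.log_pos (by norm_num)
  refine ⟨min (1 / (2880000 * 256 ^ 2 * 16 ^ 2)) (1 / ((300 ^ 8) ^ 2 * Real.log (300 ^ 8) ^ 2)),
    by positivity, fun H hH => ?_⟩
  have hlog : 0 ≤ Real.log H := Real.log_nonneg (by linarith)
  have hH0 : 0 ≤ H := by linarith
  rcases le_total (300 ^ 8) H with h | h
  · obtain ⟨n, hn, h1, h2⟩ := exists_nat_pow_eight h
    have hn' : (300 : ℝ) ≤ n := by exact_mod_cast hn
    have hLn : Real.log H ≤ 16 * Real.log n := by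
      have : H ≤ (n : ℝ) ^ 16 := by
        refine h2.trans ?_
        rw [show (n : ℝ) ^ 16 = (n : ℝ) ^ 8 * (n : ℝ) ^ 8 by ring]
        gcongr
        calc (256 : ℝ) ≤ 300 ^ 8 := by norm_num
          _ ≤ _ := by gcongr
      calc Real.log H ≤ Real.log ((n : ℝ) ^ 16) := Real.log_le_log (by linarith) this
        _ = _ := by rw [Real.log_pow]; norm_num
    calc _ ≤ 1 / (2880000 * 256 ^ 2 * 16 ^ 2) * (256 * (n : ℝ) ^ 8) ^ 2 *
          (16 * Real.log n) ^ 2 := by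
          gcongr
          exact min_le_left _ _
      _ = (n : ℝ) ^ 16 * Real.log n ^ 2 / 2880000 := by ring
      _ ≤ (dihedralQuadruples ((n : ℝ) ^ 8)).ncard := le_ncard_dihedralQuadruples_pow hn
      _ ≤ _ := Nat.cast_le.2
          (Set.ncard_le_ncard (dihedralQuadruples_mono h1) (finite_dihedralQuadruples H))
  · calc _ ≤ 1 / ((300 ^ 8) ^ 2 * Real.log (300 ^ 8) ^ 2) * (300 ^ 8) ^ 2 *
          Real.log (300 ^ 8) ^ 2 := by
          gcongr
          exact min_le_right _ _
      _ = 1 := by field_simp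
      _ ≤ _ := by exact_mod_cast one_le_ncard_dihedralQuadruples hH

end

/-- The number of `D₄` quartics has order of magnitude `H² (log H)²`. -/
theorem D4_order_of_magnitude :
    ∃ c₁ c₂ : ℝ, 0 < c₁ ∧ 0 < c₂ ∧ ∀ H : ℝ, 3 ≤ H →
      c₁ * H ^ 2 * (Real.log H) ^ 2 ≤ (quarticGalCount (DihedralGroup 4) H : ℝ) ∧
      (quarticGalCount (DihedralGroup 4) H : ℝ) ≤ c₂ * H ^ 2 * (Real.log H) ^ 2 := by
  obtain ⟨c, hc, hlow⟩ := le_ncard_dihedralQuadruples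
  exact ⟨c, 23000000, hc, by norm_num, fun H hH =>
    ⟨hlow H hH, ncard_dihedralQuadruples_le hH⟩⟩
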